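/- arXiv:2211.08955 — 3 statements merged into one kernel-verified Lean document; each statement's English description precedes it below -/
import Mathlib

section
/- Let d ≥ 1 and let P₀,…,P_N ∈ S be polynomials in the X-variables only, each homogeneous of degree d (as polynomials in X₀,…,X_N), such that the only common zero of P₀,…,P_N in ℂ^{N+1} is the origin. Then for all m, n ∈ ℕ, there exists a nonzero bihomogeneous A ∈ S of bidegree (m,n) satisfying ∑_{i=0}^{N} Pᵢ·(∂A/∂Yᵢ) = 0 if and only if d·m ≤ n. -/
open MvPolynomial

noncomputable section

/-- The polynomial ring `ℂ[Y₀,…,Y_N,X₀,…,X_N]`: the left copy of `Fin (N+1)` indexes the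
`Y`-variables, the right copy indexes the `X`-variables. -/
abbrev S (N : ℕ) : Type := MvPolynomial (Fin (N + 1) ⊕ Fin (N + 1)) ℂ

/-- Weight giving `1` to each `Yᵢ` and `0` to each `Xᵢ`. -/
def wY (N : ℕ) : (Fin (N + 1) ⊕ Fin (N + 1)) → ℕ := Sum.elim (fun _ => 1) (fun _ => 0)

/-- Weight giving `0` to each `Yᵢ` and `1` to each `Xᵢ`. -/
def wX (N : ℕ) : (Fin (N + 1) ⊕ Fin (N + 1)) → ℕ := Sum.elim (fun _ => 0) (fun _ => 1)

/-- `A` is bihomogeneous of bidegree `(m, n)`. -/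
def Bihom (N m n : ℕ) (A : S N) : Prop :=
  A.IsWeightedHomogeneous (wY N) m ∧ A.IsWeightedHomogeneous (wX N) n

/-- The operator `δ(A) = ∑ᵢ Xᵢ · ∂A/∂Yᵢ`. -/
def deltaOp (N : ℕ) (A : S N) : S N :=
  ∑ i : Fin (N + 1), X (Sum.inr i) * pderiv (Sum.inl i) A

/-- The quadratic polynomial `q = ∑ᵢ Xᵢ·Yᵢ`. -/
def qPoly (N : ℕ) : S N := ∑ i : Fin (N + 1), X (Sum.inr i) * X (Sum.inl i)

section Finiteness

variable {σ ι K : Type*} [Field K]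

attribute [local instance] MvPolynomial.gradedAlgebra in
theorem homogeneousComponent_mul_of_isHomogeneous {a f : MvPolynomial σ K} {e n : ℕ}
    (hf : f.IsHomogeneous e) :
    homogeneousComponent n (a * f) =
      if e ≤ n then homogeneousComponent (n - e) a * f else 0 := by
  simp only [← decomposition.decompose'_apply]
  exact DirectSum.coe_decompose_mul_of_right_mem (homogeneousSubmodule σ K) n hf

/-- If some power of the ideal of the variables lies in the ideal generated by homogeneous
polynomials `f i` of positive degree, then the polynomial ring is finite over `K[f]`. -/
theorem finite_adjoin_of_pow_idealOfVars_le [Finite σ] [Fintype ι]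
    {f : ι → MvPolynomial σ K} {e : ι → ℕ} (he : ∀ i, 0 < e i)
    (hf : ∀ i, (f i).IsHomogeneous (e i)) {k : ℕ}
    (hk : idealOfVars σ K ^ k ≤ Ideal.span (Set.range f)) :
    Module.Finite (Algebra.adjoin K (Set.range f)) (MvPolynomial σ K) := by
  set R := Algebra.adjoin K (Set.range f)
  have hfin : {s : σ →₀ ℕ | s.degree < k}.Finite :=
    Finsupp.finite_of_degree_lt k
  let M : Submodule R (MvPolynomial σ K) :=
    Submodule.span R ((fun s => monomial s (1 : K)) '' {s : σ →₀ ℕ | s.degree < k})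
  have hKM (c : K) {p : MvPolynomial σ K} (hp : p ∈ M) : c • p ∈ M := by
    rw [← algebraMap_smul R c p]
    exact M.smul_mem _ hp
  have hom (n : ℕ) : ∀ p : MvPolynomial σ K, p.IsHomogeneous n → p ∈ M := by
    induction n using Nat.strong_induction_on with
    | _ n ih =>
      intro p hp
      by_cases hn : n < k
      · rw [p.as_sum]
        refine Submodule.sum_mem _ fun s hs => ?_
        rw [← mul_one (coeff s p), ← smul_eq_mul, ← smul_monomial]
        refine hKM _ (Submodule.subset_span ⟨s, ?_, rfl⟩)
        rw [← of_not_not (mt hp.coeff_eq_zero (mem_support_iff.1 hs))] at hn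
        exact hn
      · have hpI : p ∈ Ideal.span (Set.range f) := by
          refine hk ((mem_pow_idealOfVars_iff' k p).2 fun s hs => hp.coeff_eq_zero (by omega))
        obtain ⟨a, ha⟩ := Ideal.mem_span_range_iff_exists_fun.1 hpI
        rw [← homogeneousComponent_eq_self hp, ← ha, map_sum]
        refine Submodule.sum_mem _ fun i _ => ?_
        rw [homogeneousComponent_mul_of_isHomogeneous (hf i)]
        split_ifs with h
        · rw [mul_comm]
          exact M.smul_mem (⟨f i, Algebra.subset_adjoin ⟨i, rfl⟩⟩ : R)
            (ih _ (by have := he i; omega) _ (homogeneousComponent_isHomogeneous _ _))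
        · exact M.zero_mem
  refine ⟨⟨(hfin.image fun s => monomial s (1 : K)).toFinset, ?_⟩⟩
  rw [Set.Finite.coe_toFinset, eq_top_iff]
  intro p _
  rw [← sum_homogeneousComponent p]
  exact Submodule.sum_mem _ fun i _ => hom i _ (homogeneousComponent_isHomogeneous _ _)

/-- Over an algebraically closed field, the polynomial ring is finite over the subalgebra generated
by homogeneous polynomials of positive degree without nontrivial common zeros. -/
theorem finite_adjoin_of_forall_eval_eq_zero [IsAlgClosed K] [Finite σ] [Fintype ι]
    {f : ι → MvPolynomial σ K} {e : ι → ℕ} (he : ∀ i, 0 < e i)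
    (hf : ∀ i, (f i).IsHomogeneous (e i))
    (hzero : ∀ x : σ → K, (∀ i, eval x (f i) = 0) → x = 0) :
    Module.Finite (Algebra.adjoin K (Set.range f)) (MvPolynomial σ K) := by
  have hrad : idealOfVars σ K ≤ (Ideal.span (Set.range f)).radical := by
    rw [← vanishingIdeal_zeroLocus_eq_radical (K := K), Ideal.span_le]
    rintro _ ⟨j, rfl⟩ x hx
    have : x = 0 := hzero x fun i => by
      simpa [aeval_eq_eval] using hx (f i) (Ideal.subset_span ⟨i, rfl⟩)
    simp [this]
  obtain ⟨k, hk⟩ := Ideal.exists_pow_le_of_le_radical_of_fg hrad (idealOfVars_fg σ K)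
  exact finite_adjoin_of_pow_idealOfVars_le he hf hk

theorem algebraicIndependent_of_finite_adjoin [Finite σ] (f : σ → MvPolynomial σ K)
    [Module.Finite (Algebra.adjoin K (Set.range f)) (MvPolynomial σ K)] :
    AlgebraicIndependent K f :=
  (Algebra.IsAlgebraic.isTranscendenceBasis_of_lift_le_trdeg_of_finite K f
    (by simp [MvPolynomial.trdeg_of_isDomain])).1

end Finiteness

section Minpoly

theorem coeff_zero_minpoly_ne_zero {R S : Type*} [CommRing R] [CommRing S] [IsDomain S]
    [Algebra R S] {a : S} (ha : IsIntegral R a) (ha0 : a ≠ 0) : (minpoly R a).coeff 0 ≠ 0 := by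
  intro h
  obtain ⟨q, hq⟩ := Polynomial.X_dvd_iff.2 h
  have : Nontrivial R := (algebraMap R S).domain_nontrivial
  have hqm : q.Monic := by
    have := minpoly.monic ha
    rw [hq] at this
    exact Polynomial.monic_X.of_mul_monic_left this
  have hqa : Polynomial.aeval a q = 0 := by
    have := minpoly.aeval R a
    rw [hq, map_mul, Polynomial.aeval_X] at this
    exact (mul_eq_zero.1 this).resolve_left ha0
  have := Polynomial.natDegree_le_natDegree (minpoly.min R a hqm hqa)
  rw [hq, Polynomial.monic_X.natDegree_mul hqm, Polynomial.natDegree_X] at this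
  omega

variable {K S : Type*} [Field K] [CommRing S] [IsDomain S] [Algebra K S]

/-- An endomorphism preserving an integrally closed subalgebra `R` and rescaling `a` rescales the
constant coefficient of the minimal polynomial of `a` over `R`. -/
theorem map_coeff_zero_minpoly_of_map_eq_smul (R : Subalgebra K S) [IsIntegrallyClosed R] {a : S}
    (ha : IsIntegral R a) (τ : S →ₐ[K] S) (hτ : ∀ r ∈ R, τ r ∈ R) {c : K} (hc : c ≠ 0)
    (hτa : τ a = c • a) :
    τ ((minpoly R a).coeff 0) = c ^ (minpoly R a).natDegree • ((minpoly R a).coeff 0 : S) := by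
  set p := minpoly R a
  have hp : p.Monic := minpoly.monic ha
  let τR : R →+* R := (τ.comp R.val).toRingHom.codRestrict R fun r => hτ r r.2
  let q := (p.map τR).scaleRoots (algebraMap K R c⁻¹)
  have hq : q.Monic := (Polynomial.monic_scaleRoots_iff _).2 (hp.map τR)
  have hqa : Polynomial.aeval a q = 0 := by
    have h0 : Polynomial.aeval (τ a) (p.map τR) = 0 := by
      have := congrArg τ (minpoly.aeval R a)
      rw [map_zero, Polynomial.aeval_def, ← AlgHom.coe_toRingHom, Polynomial.hom_eval₂] at this
      rw [Polynomial.aeval_def, Polynomial.eval₂_map]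
      exact this
    have := Polynomial.scaleRoots_aeval_eq_zero (r := algebraMap K R c⁻¹) h0
    rwa [hτa, ← IsScalarTower.algebraMap_apply, ← Algebra.smul_def, smul_smul,
      inv_mul_cancel₀ hc, one_smul] at this
  have hpq : q = p := Polynomial.eq_of_monic_of_dvd_of_natDegree_le hp hq
    (minpoly.isIntegrallyClosed_dvd ha hqa)
    (by rw [Polynomial.natDegree_scaleRoots, hp.natDegree_map])
  have h0 : τ (p.coeff 0) * algebraMap K S c⁻¹ ^ p.natDegree = (p.coeff 0 : S) := by
    have := congrArg (fun r => ((Polynomial.coeff r 0 : R) : S)) hpq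
    simp only [q, Polynomial.coeff_scaleRoots, hp.natDegree_map, Polynomial.coeff_map] at this
    exact this
  conv_rhs => rw [← h0]
  rw [Algebra.smul_def, map_pow, mul_left_comm, ← mul_pow, ← map_mul,
    mul_inv_cancel₀ hc, map_one, one_pow, mul_one]

end Minpoly

section Evaluation

theorem eval_pow_mul_of_isWeightedHomogeneous {σ R : Type*} [CommSemiring R] {w : σ → ℕ}
    {A : MvPolynomial σ R} {n : ℕ} (hA : A.IsWeightedHomogeneous w n) (t : R) (x : σ → R) :
    eval (fun i => t ^ w i * x i) A = t ^ n * eval x A := by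
  rw [eval_eq, eval_eq, Finset.mul_sum]
  refine Finset.sum_congr rfl fun s hs => ?_
  have hw : ∑ i ∈ s.support, w i * s i = n := by
    rw [← hA (mem_support_iff.1 hs), Finsupp.weight_apply, Finsupp.sum]
    exact Finset.sum_congr rfl fun i _ => by rw [smul_eq_mul, mul_comm]
  simp only [mul_pow, Finset.prod_mul_distrib, ← pow_mul, Finset.prod_pow_eq_pow_sum, hw]
  ring

variable {κ ν : Type*} [Fintype κ]

theorem derivative_aeval_line (y p : κ → ℂ) (x : ν → ℂ) (A : MvPolynomial (κ ⊕ ν) ℂ) :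
    Polynomial.derivative (aeval (Sum.elim
        (fun i => Polynomial.C (y i) + Polynomial.C (p i) * Polynomial.X)
        (fun i => Polynomial.C (x i))) A) =
      ∑ i, Polynomial.C (p i) * aeval (Sum.elim
        (fun i => Polynomial.C (y i) + Polynomial.C (p i) * Polynomial.X)
        (fun i => Polynomial.C (x i))) (pderiv (Sum.inl i) A) := by
  classical
  induction A using MvPolynomial.induction_on with
  | C a => simp [← MvPolynomial.algebraMap_eq]
  | add A B hA hB => simp [hA, hB, mul_add, Finset.sum_add_distrib]
  | mul_X A j hA =>
    simp only [map_mul, Polynomial.derivative_mul, hA, Derivation.leibniz, smul_eq_mul, map_add,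
      mul_add, Finset.sum_add_distrib, aeval_X, pderiv_X]
    rw [add_comm, Finset.sum_mul]
    congr 1
    · rcases j with j | j
      · rw [Finset.sum_eq_single j (fun i _ hij => by simp [hij.symm]) (by simp)]
        simp only [Sum.elim_inl, Pi.single_eq_same, map_one, mul_one, Polynomial.derivative_add,
          Polynomial.derivative_C, Polynomial.derivative_C_mul, Polynomial.derivative_X, zero_add]
        exact mul_comm _ _
      · simp
    · exact Finset.sum_congr rfl fun i _ => by ring

/-- A polynomial whose directional derivative along `p` vanishes at all points `(y, x)` with `x`
fixed is invariant under translations by multiples of `p`. -/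
theorem eval_add_mul_eq_of_sum_pderiv_eq_zero {p : κ → ℂ} {x : ν → ℂ}
    {A : MvPolynomial (κ ⊕ ν) ℂ}
    (hA : ∀ y : κ → ℂ, ∑ i, p i * eval (Sum.elim y x) (pderiv (Sum.inl i) A) = 0)
    (y : κ → ℂ) (l : ℂ) :
    eval (Sum.elim (fun i => y i + p i * l) x) A = eval (Sum.elim y x) A := by
  set g : MvPolynomial (κ ⊕ ν) ℂ →ₐ[ℂ] Polynomial ℂ := aeval (Sum.elim
        (fun i => Polynomial.C (y i) + Polynomial.C (p i) * Polynomial.X)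
        (fun i => Polynomial.C (x i))) with hg
  have heval (l : ℂ) (B : MvPolynomial (κ ⊕ ν) ℂ) :
      (g B).eval l = eval (Sum.elim (fun i => y i + p i * l) x) B := by
    have : (Polynomial.aeval l).comp g = aeval (Sum.elim (fun i => y i + p i * l) x) := by
      ext (i | i) <;> simp [g]
    simpa [aeval_eq_eval] using DFunLike.congr_fun this B
  have hder : Polynomial.derivative (g A) = 0 := by
    refine Polynomial.funext fun l => ?_
    rw [hg, derivative_aeval_line, ← hg]
    simpa [Polynomial.eval_finsetSum, heval] using hA _
  have h0 := heval 0 A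
  rw [← heval l A, Polynomial.eq_C_of_derivative_eq_zero hder, Polynomial.eval_C]
  rw [Polynomial.eq_C_of_derivative_eq_zero hder, Polynomial.eval_C] at h0
  simpa using h0

end Evaluation

section Growth

open Filter Topology

theorem Polynomial.eq_zero_of_tendsto_eval_zero {q : Polynomial ℂ} {z : ℕ → ℂ}
    (hz : Tendsto (fun k => ‖z k‖) atTop atTop)
    (hq : Tendsto (fun k => q.eval (z k)) atTop (𝓝 0)) : q = 0 := by
  by_cases hdeg : 0 < q.degree
  · exact absurd hq.norm (not_tendsto_nhds_of_tendsto_atTop (q.tendsto_norm_atTop hdeg hz) _)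
  · rw [Polynomial.eq_C_of_degree_le_zero (not_lt.1 hdeg)] at hq ⊢
    simp only [Polynomial.eval_C] at hq
    rw [tendsto_nhds_unique tendsto_const_nhds hq, Polynomial.C_0]

/-- A polynomial in two groups of variables which is invariant under `y ↦ y + l z` and rescaled by
`a` under `y ↦ s y` and by `c` under `z ↦ t ^ d z`, where `c < d * a`, vanishes. -/
theorem eq_zero_of_eval_semiinvariant {ν : Type*} {d a c : ℕ} (hd : 1 ≤ d)
    (hac : c < d * a) {b : MvPolynomial (ν ⊕ ν) ℂ}
    (hb : ∀ (s t l : ℂ) (y z : ν → ℂ), s ≠ 0 → t ≠ 0 →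
      eval (Sum.elim (fun i => s * y i + l * z i) (fun i => t ^ d * z i)) b =
        s ^ a * t ^ c * eval (Sum.elim y z) b) : b = 0 := by
  refine MvPolynomial.funext fun x => ?_
  obtain ⟨v, w, rfl⟩ : ∃ v w, x = Sum.elim v w := ⟨_, _, (Sum.elim_comp_inl_inr x).symm⟩
  let q : Polynomial ℂ := aeval (Sum.elim (fun i => Polynomial.C (v i))
    (fun i => Polynomial.C (w i) + Polynomial.C (v i) * Polynomial.X)) b
  have hq (u : ℂ) : q.eval u = eval (Sum.elim v fun i => w i + v i * u) b := by
    have : (Polynomial.aeval u).comp (aeval (Sum.elim (fun i => Polynomial.C (v i))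
        (fun i => Polynomial.C (w i) + Polynomial.C (v i) * Polynomial.X))) =
        aeval (R := ℂ) (Sum.elim v fun i => w i + v i * u) := by
      ext (i | i) <;> simp
    simpa [aeval_eq_eval, q] using DFunLike.congr_fun this b
  let z : ℕ → ℂ := fun k => (k : ℂ) + 1
  have hz0 (k) : z k ≠ 0 := Nat.cast_add_one_ne_zero k
  have hz : Tendsto (fun k => ‖z k‖) atTop atTop := by
    have : (fun k => ‖z k‖) = fun k : ℕ => (k : ℝ) + 1 := by
      funext k
      simp only [z]
      exact_mod_cast Complex.norm_natCast (k + 1)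
    rw [this]
    exact tendsto_atTop_add_const_right _ _ tendsto_natCast_atTop_atTop
  have hzd : Tendsto (fun k => ‖z k ^ d‖) atTop atTop := by
    simp only [norm_pow]
    exact (tendsto_pow_atTop (by omega)).comp hz
  have hzinv : Tendsto (fun k => (z k)⁻¹) atTop (𝓝 0) :=
    tendsto_inv₀_cobounded.comp (tendsto_norm_atTop_iff_cobounded.1 hz)
  have key (k : ℕ) : q.eval (z k ^ d) = (z k)⁻¹ ^ (d * a - c) * ((-1) ^ a *
      eval (Sum.elim w fun i => v i + (z k)⁻¹ ^ d * w i) b) := by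
    have h := hb (-(z k)⁻¹ ^ d) (z k) 1 w (fun i => v i + (z k)⁻¹ ^ d * w i)
      (neg_ne_zero.2 (pow_ne_zero _ (inv_ne_zero (hz0 k)))) (hz0 k)
    have hinv : z k ^ d * (z k)⁻¹ ^ d = 1 := by
      rw [← mul_pow, mul_inv_cancel₀ (hz0 k), one_pow]
    rw [hq]
    convert h using 1
    · congr 3
      · funext i; ring
      · funext i; linear_combination (-w i) * hinv
    · have : ((z k)⁻¹ ^ d) ^ a * z k ^ c = (z k)⁻¹ ^ (d * a - c) := by
        rw [← pow_mul]
        obtain ⟨j, hj⟩ := Nat.exists_eq_add_of_lt hac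
        rw [hj, show c + j + 1 - c = j + 1 by omega, add_assoc, pow_add]
        rw [mul_right_comm, ← mul_pow, inv_mul_cancel₀ (hz0 k), one_pow, one_mul]
      rw [← this, neg_pow]
      ring
  have hlim : Tendsto (fun k => q.eval (z k ^ d)) atTop (𝓝 0) := by
    simp only [key]
    have hcont : Continuous fun u : ℂ => u ^ (d * a - c) * ((-1) ^ a *
        eval (Sum.elim w fun i => v i + u ^ d * w i) b) := by
      refine (continuous_pow _).mul (continuous_const.mul
        ((MvPolynomial.continuous_eval b).comp (continuous_pi ?_)))
      rintro (i | i)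
      · exact continuous_const
      · simp only [Sum.elim_inr]; fun_prop
    have := (hcont.tendsto 0).comp hzinv
    simpa only [zero_pow (show d * a - c ≠ 0 by omega), zero_mul, Function.comp_def] using this
  have h0 := hq 0
  rw [Polynomial.eq_zero_of_tendsto_eval_zero hzd hlim] at h0
  simpa using h0.symm

end Growth

section Semiinvariants

variable {N : ℕ}

theorem isHomogeneous_of_supported_inr {d : ℕ} {p : S N}
    (hsupp : p ∈ MvPolynomial.supported ℂ
      (Set.range (Sum.inr : Fin (N + 1) → Fin (N + 1) ⊕ Fin (N + 1))))
    (hp : p.IsWeightedHomogeneous (wX N) d) : p.IsHomogeneous d := by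
  intro s hs
  rw [← hp hs, Finsupp.weight_apply, Finsupp.weight_apply]
  refine Finset.sum_congr rfl fun i hi => ?_
  obtain ⟨j, rfl⟩ := mem_supported.1 hsupp
    (mem_vars_iff_mem_support i |>.2 ⟨s, mem_support_iff.2 hs, hi⟩)
  rfl

theorem Bihom.eval_mul {m n : ℕ} {A : S N} (hA : Bihom N m n A) (s t : ℂ)
    (y x : Fin (N + 1) → ℂ) :
    eval (Sum.elim (fun i => s * y i) (fun i => t * x i)) A =
      s ^ m * t ^ n * eval (Sum.elim y x) A := by
  rw [mul_assoc, ← eval_pow_mul_of_isWeightedHomogeneous hA.2 t,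
    ← eval_pow_mul_of_isWeightedHomogeneous hA.1 s]
  congr 2
  funext i
  rcases i with i | i <;> simp [wX, wY]

theorem mul_le_of_bihom_of_sum_pderiv_eq_zero {d : ℕ} (hd : 1 ≤ d) {P : Fin (N + 1) → S N}
    (hPsupp : ∀ i, P i ∈
      MvPolynomial.supported ℂ (Set.range (Sum.inr : Fin (N + 1) → Fin (N + 1) ⊕ Fin (N + 1))))
    (hPhom : ∀ i, (P i).IsWeightedHomogeneous (wX N) d)
    (hzero : ∀ x : Fin (N + 1) → ℂ,
      (∀ i, eval (Sum.elim (fun _ => (0 : ℂ)) x) (P i) = 0) → x = 0)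
    {m n : ℕ} {A : S N} (hA0 : A ≠ 0) (hA : Bihom N m n A)
    (hPA : ∑ i : Fin (N + 1), P i * pderiv (Sum.inl i) A = 0) : d * m ≤ n := by
  have hPeval (i) (y y' x : Fin (N + 1) → ℂ) :
      eval (Sum.elim y x) (P i) = eval (Sum.elim y' x) (P i) := by
    refine eval₂Hom_congr' rfl (fun j hj _ => ?_) rfl
    obtain ⟨j, rfl⟩ := mem_supported.1 (hPsupp i) hj
    rfl
  let f : Fin (N + 1) ⊕ Fin (N + 1) → S N := Sum.elim (fun i => X (Sum.inl i)) P
  have hfin : Module.Finite (Algebra.adjoin ℂ (Set.range f)) (S N) := by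
    refine finite_adjoin_of_forall_eval_eq_zero (e := Sum.elim (fun _ => 1) fun _ => d)
      ?_ ?_ fun x hx => ?_
    · rintro (i | i)
      · exact Nat.one_pos
      · exact hd
    · rintro (i | i)
      · exact isHomogeneous_X _ _
      · exact isHomogeneous_of_supported_inr (hPsupp i) (hPhom i)
    · have hx1 (i) : x (Sum.inl i) = 0 := by simpa [f] using hx (Sum.inl i)
      have hx2 := hzero (x ∘ Sum.inr) fun i => by
        rw [hPeval i _ (x ∘ Sum.inl), Sum.elim_comp_inl_inr]
        exact hx (Sum.inr i)
      funext i
      rcases i with i | i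
      · exact hx1 i
      · exact congrFun hx2 i
  have hind : AlgebraicIndependent ℂ f := algebraicIndependent_of_finite_adjoin f
  set R := Algebra.adjoin ℂ (Set.range f) with hR
  have : IsIntegrallyClosed R := .of_equiv hind.aevalEquiv.toRingEquiv
  have hAint : IsIntegral R A := Algebra.IsIntegral.isIntegral A
  set r := (minpoly R A).natDegree
  obtain ⟨b, hb⟩ : ∃ b, aeval f b = ((minpoly R A).coeff 0 : S N) := by
    have hrange : R = (aeval f).range := Algebra.adjoin_range_eq_range_aeval ℂ f
    exact hrange.le ((minpoly R A).coeff 0).2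
  have hbinv (s t l : ℂ) (y z : Fin (N + 1) → ℂ) (hs : s ≠ 0) (ht : t ≠ 0) :
      eval (Sum.elim (fun i => s * y i + l * z i) (fun i => t ^ d * z i)) b =
        s ^ (m * r) * t ^ (n * r) * eval (Sum.elim y z) b := by
    let τ : S N →ₐ[ℂ] S N := aeval (Sum.elim
      (fun i => C s * X (Sum.inl i) + C l * P i) (fun i => C t * X (Sum.inr i)))
    let ρ : S N →ₐ[ℂ] S N := aeval (Sum.elim
      (fun i => C s * X (Sum.inl i) + C l * X (Sum.inr i)) (fun i => C (t ^ d) * X (Sum.inr i)))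
    have hτeval (B : S N) (x : Fin (N + 1) ⊕ Fin (N + 1) → ℂ) :
        eval x (τ B) = eval (Sum.elim (fun i => s * x (Sum.inl i) + l * eval x (P i))
          (fun i => t * x (Sum.inr i))) B := by
      have : (aeval (R := ℂ) x).comp τ = aeval (Sum.elim
          (fun i => s * x (Sum.inl i) + l * eval x (P i)) (fun i => t * x (Sum.inr i))) := by
        ext (i | i) <;> simp [τ, aeval_eq_eval]
      simpa [aeval_eq_eval] using DFunLike.congr_fun this B
    have hτP (i) : τ (P i) = C (t ^ d) * P i := by
      refine MvPolynomial.funext fun x => ?_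
      obtain ⟨v, w, rfl⟩ : ∃ v w, x = Sum.elim v w := ⟨_, _, (Sum.elim_comp_inl_inr x).symm⟩
      rw [hτeval, hPeval i _ v, map_mul, eval_C,
        ← eval_pow_mul_of_isWeightedHomogeneous (hPhom i) t]
      congr 2
      funext j
      rcases j with j | j <;> simp [wX]
    have hτρ (B : S N) : τ (aeval f B) = aeval f (ρ B) := by
      have : τ.comp (aeval f) = (aeval f).comp ρ := by
        ext1 i
        rcases i with i | i
        · simp [τ, ρ, f, ← MvPolynomial.algebraMap_eq]
        · simpa [ρ, f, ← MvPolynomial.algebraMap_eq] using hτP i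
      exact DFunLike.congr_fun this B
    have hτA : τ A = (s ^ m * t ^ n) • A := by
      refine MvPolynomial.funext fun x => ?_
      obtain ⟨v, w, rfl⟩ : ∃ v w, x = Sum.elim v w := ⟨_, _, (Sum.elim_comp_inl_inr x).symm⟩
      rw [hτeval, smul_eval, ← hA.eval_mul]
      simp only [Sum.elim_inl, Sum.elim_inr]
      have htr := eval_add_mul_eq_of_sum_pderiv_eq_zero (A := A) (x := fun i => t * w i)
        (p := fun i => t ^ d * eval (Sum.elim v w) (P i)) (fun y => ?_) (fun i => s * v i)
        (l / t ^ d)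
      · rw [← htr]
        congr 3
        funext i
        field_simp
      · have := congrArg (eval (Sum.elim y fun i => t * w i)) hPA
        simp only [map_sum, map_mul, map_zero] at this
        rw [← this]
        refine Finset.sum_congr rfl fun i _ => ?_
        rw [← eval_pow_mul_of_isWeightedHomogeneous (hPhom i) t, hPeval i y v]
        congr 3
        funext j
        rcases j with j | j <;> simp [wX]
    have hτR : ∀ B ∈ R, τ B ∈ R := by
      intro B hB
      rw [hR, Algebra.adjoin_range_eq_range_aeval] at hB ⊢
      obtain ⟨B, rfl⟩ := hB
      exact ⟨ρ B, (hτρ B).symm⟩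
    have hmin := map_coeff_zero_minpoly_of_map_eq_smul R hAint τ hτR
      (mul_ne_zero (pow_ne_zero m hs) (pow_ne_zero n ht)) hτA
    rw [← hb, hτρ, ← map_smul] at hmin
    have hρ := congrArg (eval (Sum.elim y z)) (hind hmin)
    rw [smul_eval, mul_pow, ← pow_mul, ← pow_mul] at hρ
    rw [← hρ]
    have : (aeval (R := ℂ) (Sum.elim y z)).comp ρ = aeval (Sum.elim
        (fun i => s * y i + l * z i) (fun i => t ^ d * z i)) := by
      ext (i | i) <;> simp [ρ, aeval_eq_eval]
    simpa [aeval_eq_eval] using (DFunLike.congr_fun this b).symm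
  by_contra! hlt
  have hr : 0 < r := minpoly.natDegree_pos hAint
  have hb0 := eq_zero_of_eval_semiinvariant hd
    (by rw [← mul_assoc]; exact Nat.mul_lt_mul_of_pos_right hlt hr) hbinv
  rw [hb0, map_zero] at hb
  exact coeff_zero_minpoly_ne_zero hAint hA0 (Subtype.ext hb.symm)

theorem exists_bihom_sum_pderiv_eq_zero (hN : 1 ≤ N) {d : ℕ} {P : Fin (N + 1) → S N}
    (hPsupp : ∀ i, P i ∈
      MvPolynomial.supported ℂ (Set.range (Sum.inr : Fin (N + 1) → Fin (N + 1) ⊕ Fin (N + 1))))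
    (hPhom : ∀ i, (P i).IsWeightedHomogeneous (wX N) d) {i : Fin (N + 1)} (hi : P i ≠ 0)
    {m n : ℕ} (hmn : d * m ≤ n) :
    ∃ A : S N, A ≠ 0 ∧ Bihom N m n A ∧
      ∑ i : Fin (N + 1), P i * pderiv (Sum.inl i) A = 0 := by
  have : Nontrivial (Fin (N + 1)) := Fin.nontrivial_iff_two_le.2 (by omega)
  obtain ⟨j, hj⟩ := exists_ne i
  have hPinl (k l) : Sum.inl l ∉ (P k).vars := fun h => by
    simpa using mem_supported.1 (hPsupp k) h
  have hPder (k l) : pderiv (Sum.inl l) (P k) = 0 := pderiv_eq_zero_of_notMem_vars (hPinl k l)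
  have hPY (k) : (P k).IsWeightedHomogeneous (wY N) 0 := by
    intro s hs
    rw [Finsupp.weight_apply]
    refine Finset.sum_eq_zero fun a ha => ?_
    obtain ⟨b, rfl⟩ := mem_supported.1 (hPsupp k)
      (mem_vars_iff_mem_support a |>.2 ⟨s, mem_support_iff.2 hs, ha⟩)
    simp [wY]
  let D : Derivation ℂ (S N) (S N) := ∑ k, P k • pderiv (Sum.inl k)
  have hD (B : S N) : D B = ∑ k, P k * pderiv (Sum.inl k) B := by
    have := congrFun (map_sum Derivation.coeFnAddMonoidHom
      (fun k => P k • pderiv (Sum.inl k)) Finset.univ) B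
    rw [Finset.sum_apply] at this
    exact this
  have hDX (k) : D (X (Sum.inl k)) = P k := by
    classical
    simp [hD, pderiv_X, Pi.single_apply]
  have hDP (k) : D (P k) = 0 := by simp [hD, hPder]
  let E : S N := P i * X (Sum.inl j) - P j * X (Sum.inl i)
  have hDE : D E = 0 := by
    simp only [E, map_sub, Derivation.leibniz, hDX, hDP, smul_eq_mul]
    ring
  have hE0 : E ≠ 0 := by
    intro h
    have h' := congrArg (pderiv (Sum.inl j)) h
    have hji : (Sum.inl i : Fin (N + 1) ⊕ Fin (N + 1)) ≠ Sum.inl j := by simpa using hj.symm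
    simp [E, Derivation.leibniz, hPder, pderiv_X_of_ne hji, hi] at h'
  refine ⟨E ^ m * X (Sum.inr 0) ^ (n - d * m),
    mul_ne_zero (pow_ne_zero _ hE0) (pow_ne_zero _ (X_ne_zero _)), ⟨?_, ?_⟩, ?_⟩
  · have hE : E.IsWeightedHomogeneous (wY N) 1 :=
      (by simpa [wY] using (hPY i).mul (isWeightedHomogeneous_X ℂ (wY N) (Sum.inl j)) :
        (P i * X (Sum.inl j)).IsWeightedHomogeneous (wY N) 1).sub
      (by simpa [wY] using (hPY j).mul (isWeightedHomogeneous_X ℂ (wY N) (Sum.inl i)))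
    have := (hE.pow m).mul
      ((isWeightedHomogeneous_X ℂ (wY N) (Sum.inr 0)).pow (n - d * m))
    simpa [wY] using this
  · have hE : E.IsWeightedHomogeneous (wX N) d :=
      (by simpa [wX] using (hPhom i).mul (isWeightedHomogeneous_X ℂ (wX N) (Sum.inl j)) :
        (P i * X (Sum.inl j)).IsWeightedHomogeneous (wX N) d).sub
      (by simpa [wX] using (hPhom j).mul (isWeightedHomogeneous_X ℂ (wX N) (Sum.inl i)))
    have := (hE.pow m).mul
      ((isWeightedHomogeneous_X ℂ (wX N) (Sum.inr 0)).pow (n - d * m))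
    have hdeg : m * d + (n - d * m) = n := by rw [mul_comm m]; omega
    simpa [wX, hdeg] using this
  · rw [← hD]
    have hDX0 : D (X (Sum.inr 0)) = 0 := by simp [hD]
    simp [Derivation.leibniz, Derivation.leibniz_pow, hDE, hDX0]

end Semiinvariants

/-- For `P₀,…,P_N` homogeneous of degree `d ≥ 1` in the `X`-variables only,
with only common zero the origin, the PDE `∑ᵢ Pᵢ ∂A/∂Yᵢ = 0` has a nonzero bihomogeneous
solution of bidegree `(m, n)` iff `d·m ≤ n`. -/
theorem statement0 (N : ℕ) (hN : 2 ≤ N) (d : ℕ) (hd : 1 ≤ d)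
    (P : Fin (N + 1) → S N)
    (hPsupp : ∀ i, P i ∈
      MvPolynomial.supported ℂ (Set.range (Sum.inr : Fin (N + 1) → Fin (N + 1) ⊕ Fin (N + 1))))
    (hPhom : ∀ i, (P i).IsWeightedHomogeneous (wX N) d)
    (hzero : ∀ x : Fin (N + 1) → ℂ,
      (∀ i, eval (Sum.elim (fun _ => (0 : ℂ)) x) (P i) = 0) → x = 0)
    (m n : ℕ) :
    (∃ A : S N, A ≠ 0 ∧ Bihom N m n A ∧
        ∑ i : Fin (N + 1), P i * pderiv (Sum.inl i) A = 0) ↔ d * m ≤ n := by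
  constructor
  · rintro ⟨A, hA0, hA, hPA⟩
    exact mul_le_of_bihom_of_sum_pderiv_eq_zero hd hPsupp hPhom hzero hA0 hA hPA
  · intro hmn
    obtain ⟨i, hi⟩ : ∃ i, P i ≠ 0 := by
      by_contra! h
      have := congrFun (hzero (fun _ => 1) fun i => by simp [h i]) 0
      exact one_ne_zero this
    exact exists_bihom_sum_pderiv_eq_zero (by omega) hPsupp hPhom hi hmn
end
end

section
/- Let d ≥ 3 and let F ∈ S be a polynomial in the X-variables X₀,…,X_{N−1} only (involving neither X_N nor any Yᵢ), homogeneous of degree d, such that the only common zero in ℂ^N of the partial derivatives ∂F/∂X₀,…,∂F/∂X_{N−1} is the origin. Set P := X_N^d − F, and let I be the ideal of S generated by P and q. Let m, k ∈ ℕ with m·(d−2) > k (equivalently, writing k = m+n, with m·(d−3) > n). Then for every bihomogeneous A ∈ S of bidegree (m,k): if ∑_{i=0}^{N} (∂P/∂Xᵢ)·(∂A/∂Yᵢ) ∈ I, then A ∈ I. -/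
open MvPolynomial

noncomputable section

section WeightShift

variable {τ : Type*}

theorem eq_sum_weightedHomogeneousComponent (w : τ → ℤ) (p : MvPolynomial τ ℂ) :
    ∃ t : Finset ℤ, p = ∑ n ∈ t, weightedHomogeneousComponent w n p := by
  refine ⟨(weightedHomogeneousComponent_finsupp (w := w) p).toFinset, ?_⟩
  rw [← finsum_eq_sum _ (weightedHomogeneousComponent_finsupp p),
    sum_weightedHomogeneousComponent]

variable [Fintype τ]

theorem derivation_aeval {R : Type*} [CommRing R] [Algebra ℂ R] (D : Derivation ℂ R R) (x : τ → R)
    (p : MvPolynomial τ ℂ) : D (aeval x p) = ∑ i, aeval x (pderiv i p) * D (x i) := by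
  classical
  induction p using MvPolynomial.induction_on with
  | C a => simp
  | add p q hp hq => simp only [map_add, hp, hq, add_mul, Finset.sum_add_distrib]
  | mul_X p j hp =>
    simp only [map_mul, Derivation.leibniz, smul_eq_mul, hp, map_add, aeval_X, pderiv_X,
      Pi.single_apply, add_mul, Finset.sum_add_distrib]
    congr 1
    · simp [apply_ite]
    · simp only [Finset.mul_sum, mul_assoc]

theorem mkDerivation_eq_sum_mul_pderiv (v : τ → MvPolynomial τ ℂ) (p : MvPolynomial τ ℂ) :
    mkDerivation ℂ v p = ∑ i, v i * pderiv i p := by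
  simpa [mul_comm] using derivation_aeval (mkDerivation ℂ v) X p

theorem isWeightedHomogeneous_mkDerivation {w : τ → ℤ} {s n : ℤ} {v : τ → MvPolynomial τ ℂ}
    (hv : ∀ i, (v i).IsWeightedHomogeneous w (w i + s)) {p : MvPolynomial τ ℂ}
    (hp : p.IsWeightedHomogeneous w n) :
    (mkDerivation ℂ v p).IsWeightedHomogeneous w (n + s) := by
  rw [mkDerivation_eq_sum_mul_pderiv]
  refine IsWeightedHomogeneous.sum _ _ _ fun i _ => ?_
  have h := (hv i).mul (hp.pderiv (i := i) (n' := n - w i) (by ring))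
  rwa [show w i + s + (n - w i) = n + s by ring] at h

/-- A derivation shifting weights by `s` commutes with taking homogeneous components. -/
theorem mkDerivation_weightedHomogeneousComponent {w : τ → ℤ} {s : ℤ}
    {v : τ → MvPolynomial τ ℂ} (hv : ∀ i, (v i).IsWeightedHomogeneous w (w i + s))
    (p : MvPolynomial τ ℂ) (n : ℤ) :
    mkDerivation ℂ v (weightedHomogeneousComponent w n p) =
      weightedHomogeneousComponent w (n + s) (mkDerivation ℂ v p) := by
  classical
  obtain ⟨t, ht⟩ := eq_sum_weightedHomogeneousComponent w p
  have hshift : ∀ l, weightedHomogeneousComponent w (n + s)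
      (mkDerivation ℂ v (weightedHomogeneousComponent w l p)) =
      if n = l then mkDerivation ℂ v (weightedHomogeneousComponent w l p) else 0 := fun l => by
    rw [weightedHomogeneousComponent_of_mem (isWeightedHomogeneous_mkDerivation hv
      (weightedHomogeneousComponent_isWeightedHomogeneous l p))]
    simp
  have hn : ∀ l, weightedHomogeneousComponent w n (weightedHomogeneousComponent w l p) =
      if n = l then weightedHomogeneousComponent w l p else 0 := fun l =>
    weightedHomogeneousComponent_of_mem (weightedHomogeneousComponent_isWeightedHomogeneous l p)
  conv_rhs => rw [ht]
  conv_lhs => rw [ht]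
  simp only [map_sum, hshift, hn]
  exact Finset.sum_congr rfl fun l _ => by split_ifs <;> simp

/-- Euler's identity for integer weights. -/
theorem mkDerivation_weight_X {w : τ → ℤ} {n : ℤ} {p : MvPolynomial τ ℂ}
    (hp : p.IsWeightedHomogeneous w n) :
    mkDerivation ℂ (fun i => (w i : MvPolynomial τ ℂ) * X i) p = (n : MvPolynomial τ ℂ) * p := by
  induction hp using IsWeightedHomogeneous.induction_on with
  | zero => simp
  | add p q hp hq h1 h2 => rw [map_add, h1, h2, mul_add]
  | monomial d r hr =>
    rw [mkDerivation_eq_sum_mul_pderiv]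
    simp_rw [mul_assoc, X_mul_pderiv_monomial]
    rw [← hr, Finsupp.weight_apply, Finsupp.sum_fintype _ _ (by simp)]
    push_cast
    rw [Finset.sum_mul]
    refine Finset.sum_congr rfl fun i _ => ?_
    simp only [nsmul_eq_mul]
    push_cast
    ring

end WeightShift

section LocallyNilpotent

variable {A : Type*} [CommRing A] [Algebra ℂ A]

theorem Derivation.iterate_add_mul_eq_zero (D : Derivation ℂ A A) (a b : A) (k l : ℕ)
    (ha : D^[k] a = 0) (hb : D^[l] b = 0) : D^[k + l] (a * b) = 0 := by
  have hz : ∀ n : ℕ, D^[n] 0 = 0 := fun n => iterate_map_zero D n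
  obtain ⟨s, hs⟩ : ∃ s, s = k + l := ⟨_, rfl⟩
  induction s generalizing a b k l with
  | zero =>
    obtain ⟨rfl, rfl⟩ : k = 0 ∧ l = 0 := by omega
    simp at ha
    simp [ha]
  | succ s ih =>
    rcases k with _ | k
    · simp at ha; simp [ha, hz]
    rcases l with _ | l
    · simp at hb; simp [hb, hz]
    rw [← hs, Function.iterate_succ_apply, D.leibniz, iterate_map_add, smul_eq_mul, smul_eq_mul]
    have h1 := ih a (D b) (k + 1) l ha (by simpa using hb) (by omega)
    have h2 := ih b (D a) (l + 1) k hb (by simpa using ha) (by omega)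
    rw [show s = k + 1 + l by omega, h1, show k + 1 + l = l + 1 + k by omega, h2, add_zero]

theorem exists_iterate_derivation_eq_zero {τ : Type*}
    (D : Derivation ℂ (MvPolynomial τ ℂ) (MvPolynomial τ ℂ))
    (hD : ∀ i, ∃ k, D^[k] (X i) = 0) (p : MvPolynomial τ ℂ) : ∃ k, D^[k] p = 0 := by
  induction p using MvPolynomial.induction_on with
  | C a => exact ⟨1, by simp⟩
  | add p q hp hq =>
    obtain ⟨k, hk⟩ := hp
    obtain ⟨l, hl⟩ := hq
    refine ⟨k + l, ?_⟩
    rw [iterate_map_add, add_comm k l, Function.iterate_add_apply, hk, add_comm l k,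
      Function.iterate_add_apply, hl, iterate_map_zero, iterate_map_zero, add_zero]
  | mul_X p i hp =>
    obtain ⟨k, hk⟩ := hp
    obtain ⟨l, hl⟩ := hD i
    exact ⟨k + l, D.iterate_add_mul_eq_zero _ _ _ _ hk hl⟩

end LocallyNilpotent

section Polarization

variable {σ : Type*}

/-- The derivation `∑ᵢ fᵢ ∂/∂bᵢ` of `ℂ[b, x]`, the left variables being `b`. -/
def leftDer (f : σ → MvPolynomial (σ ⊕ σ) ℂ) :
    Derivation ℂ (MvPolynomial (σ ⊕ σ) ℂ) (MvPolynomial (σ ⊕ σ) ℂ) :=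
  mkDerivation ℂ (Sum.elim f 0)

/-- The weight `-1` on the left variables and `1` on the right ones. -/
def polWeight (σ : Type*) : σ ⊕ σ → ℤ := Sum.elim (fun _ => -1) (fun _ => 1)

variable [Fintype σ]

theorem eq_zero_of_polarization_eq_zero {n : ℤ} (hn : n < 0) {c : MvPolynomial (σ ⊕ σ) ℂ}
    (hc : c.IsWeightedHomogeneous (polWeight σ) n)
    (hEc : leftDer (fun i => X (Sum.inr i)) c = 0) : c = 0 := by
  set E : Derivation ℂ (MvPolynomial (σ ⊕ σ) ℂ) (MvPolynomial (σ ⊕ σ) ℂ) :=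
    leftDer (fun i => X (Sum.inr i)) with hE
  let G : Derivation ℂ (MvPolynomial (σ ⊕ σ) ℂ) (MvPolynomial (σ ⊕ σ) ℂ) :=
    mkDerivation ℂ (Sum.elim 0 (fun i => X (Sum.inl i)))
  let H : Derivation ℂ (MvPolynomial (σ ⊕ σ) ℂ) (MvPolynomial (σ ⊕ σ) ℂ) :=
    mkDerivation ℂ (fun i => (polWeight σ i : MvPolynomial (σ ⊕ σ) ℂ) * X i)
  have hcomm : ∀ p, E (G p) = G (E p) + H p := fun p => by
    have h : ⁅E, G⁆ = H := by
      refine derivation_ext fun i => ?_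
      rcases i with i | i <;> simp [Derivation.commutator_apply, E, G, H, leftDer, polWeight]
    rw [← h, Derivation.commutator_apply]
    ring
  have hGwt : ∀ j : ℕ, (G^[j] c).IsWeightedHomogeneous (polWeight σ) (n - 2 * j) := fun j => by
    induction j with
    | zero => simpa using hc
    | succ j ih =>
      rw [Function.iterate_succ_apply']
      have := isWeightedHomogeneous_mkDerivation (s := -2)
        (v := Sum.elim 0 (fun i => X (Sum.inl i))) (fun i => by
          rcases i with i | i
          · exact isWeightedHomogeneous_zero _ _ _
          · exact isWeightedHomogeneous_X ℂ (polWeight σ) (Sum.inl i)) ih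
      convert this using 1
      push_cast; ring
  have hEG : ∀ j : ℕ, E (G^[j + 1] c) =
      (((j + 1 : ℤ) * (n - j) : ℤ) : MvPolynomial (σ ⊕ σ) ℂ) * G^[j] c := fun j => by
    induction j with
    | zero =>
      have := mkDerivation_weight_X hc
      simp only [zero_add, Function.iterate_one, Function.iterate_zero, id, hcomm, hEc, map_zero]
      rw [this]; simp
    | succ j ih =>
      have hH := mkDerivation_weight_X (hGwt (j + 1))
      rw [Function.iterate_succ_apply', hcomm, ih, ← zsmul_eq_mul, map_zsmul,
        ← Function.iterate_succ_apply' G, hH, zsmul_eq_mul, ← add_mul, ← Int.cast_add]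
      congr 2
      push_cast; ring
  obtain ⟨k, hk⟩ := exists_iterate_derivation_eq_zero G (fun i => by
    rcases i with i | i
    · exact ⟨1, by simp [G]⟩
    · exact ⟨2, by simp [G]⟩) c
  induction k with
  | zero => simpa using hk
  | succ k ih =>
    refine ih ?_
    have h := hEG k
    rw [hk, map_zero] at h
    refine (mul_eq_zero.mp h.symm).resolve_left ?_
    refine Int.cast_ne_zero.mpr ?_
    exact mul_ne_zero (by positivity) (by omega)

theorem weightedHomogeneousComponent_eq_zero_of_polarization {c : MvPolynomial (σ ⊕ σ) ℂ}
    (hEc : leftDer (fun i => X (Sum.inr i)) c = 0) {n : ℤ} (hn : n < 0) :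
    weightedHomogeneousComponent (polWeight σ) n c = 0 := by
  refine eq_zero_of_polarization_eq_zero hn
    (weightedHomogeneousComponent_isWeightedHomogeneous n c) ?_
  rw [leftDer] at hEc ⊢
  rw [mkDerivation_weightedHomogeneousComponent (s := 2), hEc, map_zero]
  rintro (i | i)
  · exact isWeightedHomogeneous_X ℂ (polWeight σ) (Sum.inr i)
  · exact isWeightedHomogeneous_zero _ _ _

end Polarization

section Integrality

variable {σ : Type*}

theorem homogeneousComponent_add_mul {f : MvPolynomial σ ℂ} {e : ℕ} (hf : f.IsHomogeneous e)
    (a : MvPolynomial σ ℂ) (n : ℕ) :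
    homogeneousComponent (n + e) (a * f) = homogeneousComponent n a * f := by
  classical
  have hl : ∀ l, homogeneousComponent (n + e) (homogeneousComponent l a * f) =
      if n = l then homogeneousComponent l a * f else 0 := fun l => by
    rw [homogeneousComponent_of_mem ((homogeneousComponent_isHomogeneous l a).mul hf)]
    simp
  have hn : homogeneousComponent n a = ∑ l ∈ Finset.range (a.totalDegree + 1),
      if n = l then homogeneousComponent l a else 0 := by
    rw [Finset.sum_ite_eq]
    split_ifs with h
    · rfl
    · exact homogeneousComponent_eq_zero _ _ (by simpa using h)
  conv_lhs => rw [← sum_homogeneousComponent a]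
  rw [hn, Finset.sum_mul, Finset.sum_mul, map_sum]
  exact Finset.sum_congr rfl fun l _ => by rw [hl]; split_ifs <;> simp

variable [Fintype σ]

/-- Homogeneous polynomials without a common zero outside the origin cut out the polynomial ring
as an integral extension of the subalgebra they generate. -/
theorem isIntegral_adjoin_range_X {f : σ → MvPolynomial σ ℂ} {e : ℕ} (he : 0 < e)
    (hf : ∀ i, (f i).IsHomogeneous e) (hzero : ∀ x : σ → ℂ, (∀ i, eval x (f i) = 0) → x = 0)
    (j : σ) : IsIntegral (Algebra.adjoin ℂ (Set.range f)) (X j : MvPolynomial σ ℂ) := by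
  set I : Ideal (MvPolynomial σ ℂ) := Ideal.span (Set.range f) with hI
  have hvars : idealOfVars σ ℂ ≤ I.radical := by
    rw [idealOfVars, Ideal.span_le]
    rintro _ ⟨i, rfl⟩
    rw [SetLike.mem_coe, ← vanishingIdeal_zeroLocus_eq_radical (K := ℂ), mem_vanishingIdeal_iff]
    intro x hx
    have hx0 : x = 0 := hzero x fun i => by
      simpa [aeval_eq_eval] using hx (f i) (Ideal.subset_span ⟨i, rfl⟩)
    simp [hx0]
  obtain ⟨n, hn⟩ := I.exists_radical_pow_le_of_fg (I.radical.fg_of_isNoetherianRing)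
  have hmem : ∀ s : σ →₀ ℕ, s.degree = n + e → (monomial s (1 : ℂ)) ∈ I := fun s hs =>
    hn (Ideal.pow_right_mono hvars n
      ((monomial_mem_pow_idealOfVars_iff n s one_ne_zero).mpr (by omega)))
  set M : Submodule (Algebra.adjoin ℂ (Set.range f)) (MvPolynomial σ ℂ) :=
    Submodule.span _ ((fun s => monomial s (1 : ℂ)) '' {s : σ →₀ ℕ | s.degree < n + e}) with hM
  have hlow : ∀ p : MvPolynomial σ ℂ, (∀ s ∈ p.support, s.degree < n + e) → p ∈ M := by
    intro p hp
    rw [p.as_sum]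
    refine M.sum_mem fun s hs => ?_
    have : monomial s (coeff s p) =
        (algebraMap ℂ (Algebra.adjoin ℂ (Set.range f)) (coeff s p)) • monomial s (1 : ℂ) := by
      rw [algebraMap_smul, smul_monomial, smul_eq_mul, mul_one]
    rw [this]
    exact M.smul_mem _ (Submodule.subset_span ⟨s, hp s hs, rfl⟩)
  refine isIntegral_of_smul_mem_submodule M ?_ ?_ (X j) ?_
  · refine (Submodule.ne_bot_iff _).mpr ⟨1, hlow 1 fun s hs => ?_, one_ne_zero⟩
    have hs0 : s = 0 := by simpa using hs
    rw [hs0, map_zero]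
    omega
  · exact Submodule.fg_span ((Finsupp.finite_of_degree_lt (n + e)).image _)
  · intro p hp
    induction hp using Submodule.span_induction with
    | zero => simp
    | add p q _ _ hp hq => rw [smul_add]; exact M.add_mem hp hq
    | smul a p _ hp => rw [smul_comm]; exact M.smul_mem a hp
    | mem p hp =>
      obtain ⟨s, hs, rfl⟩ := hp
      have hXs : (X j : MvPolynomial σ ℂ) • monomial s (1 : ℂ) =
          monomial (Finsupp.single j 1 + s) 1 := by
        rw [smul_eq_mul, X, monomial_mul, one_mul]
      have hdeg : (Finsupp.single j 1 + s).degree = s.degree + 1 := by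
        rw [map_add, Finsupp.degree_single, add_comm]
      have hs' : s.degree < n + e := hs
      simp only [hXs]
      by_cases hlt : s.degree + 1 < n + e
      · refine hlow _ fun t ht => ?_
        have := Finset.mem_singleton.mp (support_monomial_subset ht)
        rwa [this, hdeg]
      · have htop : (Finsupp.single j 1 + s).degree = n + e := by omega
        obtain ⟨a, ha⟩ := (Submodule.mem_span_range_iff_exists_fun _).mp (hmem _ htop)
        have hcomp : monomial (Finsupp.single j 1 + s) (1 : ℂ) =
            ∑ i, homogeneousComponent n (a i) * f i := by
          have h := congrArg (homogeneousComponent (n + e)) ha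
          rw [map_sum, homogeneousComponent_eq_self (isHomogeneous_monomial _ htop)] at h
          rw [← h]
          exact Finset.sum_congr rfl fun i _ => by
            rw [smul_eq_mul, homogeneousComponent_add_mul (hf i)]
        rw [hcomp]
        refine M.sum_mem fun i _ => ?_
        have : homogeneousComponent n (a i) * f i =
            (⟨f i, Algebra.subset_adjoin ⟨i, rfl⟩⟩ : Algebra.adjoin ℂ (Set.range f)) •
              homogeneousComponent n (a i) := by
          rw [Subalgebra.smul_def, smul_eq_mul, mul_comm]
        rw [this]
        refine M.smul_mem _ (hlow _ fun t ht => ?_)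
        have := homogeneousComponent_isHomogeneous n (a i) (mem_support_iff.mp ht)
        have hdt : t.degree = n := by rw [Finsupp.degree_eq_weight_one]; exact this
        omega

/-- The generators `b` and `f(x)` of a subalgebra of `ℂ[b, x]`. -/
def leftVarsAnd (f : σ → MvPolynomial σ ℂ) : σ ⊕ σ → MvPolynomial (σ ⊕ σ) ℂ :=
  Sum.elim (fun i => X (Sum.inl i)) (fun i => rename Sum.inr (f i))

theorem isIntegral_adjoin_leftVarsAnd {f : σ → MvPolynomial σ ℂ} {e : ℕ} (he : 0 < e)
    (hf : ∀ i, (f i).IsHomogeneous e) (hzero : ∀ x : σ → ℂ, (∀ i, eval x (f i) = 0) → x = 0)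
    (p : MvPolynomial (σ ⊕ σ) ℂ) :
    IsIntegral (Algebra.adjoin ℂ (Set.range (leftVarsAnd f))) p := by
  induction p using MvPolynomial.induction_on with
  | C a => exact isIntegral_algebraMap (x := algebraMap ℂ _ a)
  | add p q hp hq => exact hp.add hq
  | mul_X p i hp =>
    refine hp.mul ?_
    rcases i with i | i
    · exact isIntegral_algebraMap
        (x := (⟨X (Sum.inl i), Algebra.subset_adjoin ⟨Sum.inl i, rfl⟩⟩ :
          Algebra.adjoin ℂ (Set.range (leftVarsAnd f))))
    · have hle : (Algebra.adjoin ℂ (Set.range f)).map (rename Sum.inr) ≤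
          Algebra.adjoin ℂ (Set.range (leftVarsAnd f)) := by
        rw [AlgHom.map_adjoin]
        refine Algebra.adjoin_mono ?_
        rintro _ ⟨_, ⟨i, rfl⟩, rfl⟩
        exact ⟨Sum.inr i, rfl⟩
      let ι : MvPolynomial σ ℂ →ₐ[ℂ] MvPolynomial (σ ⊕ σ) ℂ := rename Sum.inr
      let g : Algebra.adjoin ℂ (Set.range f) →ₐ[ℂ] Algebra.adjoin ℂ (Set.range (leftVarsAnd f)) :=
        (ι.comp (Algebra.adjoin ℂ (Set.range f)).val).codRestrict _ fun y => hle ⟨y, y.2, rfl⟩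
      have h := IsIntegral.map_of_comp_eq g.toRingHom ι.toRingHom (RingHom.ext fun _ => rfl)
        (isIntegral_adjoin_range_X he hf hzero i)
      simpa [ι] using h

theorem algebraicIndependent_leftVarsAnd {f : σ → MvPolynomial σ ℂ} {e : ℕ} (he : 0 < e)
    (hf : ∀ i, (f i).IsHomogeneous e)
    (hzero : ∀ x : σ → ℂ, (∀ i, eval x (f i) = 0) → x = 0) :
    AlgebraicIndependent ℂ (leftVarsAnd f) := by
  have hint : Algebra.IsIntegral (Algebra.adjoin ℂ (Set.range (leftVarsAnd f)))
      (MvPolynomial (σ ⊕ σ) ℂ) := ⟨isIntegral_adjoin_leftVarsAnd he hf hzero⟩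
  refine (Algebra.IsAlgebraic.isTranscendenceBasis_of_lift_le_trdeg_of_finite ℂ
    (leftVarsAnd f) ?_).1
  rw [MvPolynomial.trdeg_of_isDomain, Cardinal.lift_id'.{0}]

theorem isIntegralElem_aeval_leftVarsAnd {f : σ → MvPolynomial σ ℂ} {e : ℕ} (he : 0 < e)
    (hf : ∀ i, (f i).IsHomogeneous e) (hzero : ∀ x : σ → ℂ, (∀ i, eval x (f i) = 0) → x = 0)
    (p : MvPolynomial (σ ⊕ σ) ℂ) :
    (aeval (leftVarsAnd f) : MvPolynomial (σ ⊕ σ) ℂ →ₐ[ℂ] _).toRingHom.IsIntegralElem p := by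
  have hx := algebraicIndependent_leftVarsAnd he hf hzero
  obtain ⟨P, hP, hPp⟩ := isIntegral_adjoin_leftVarsAnd he hf hzero p
  refine ⟨P.map (hx.aevalEquiv.symm : _ →+* _), hP.map _, ?_⟩
  rw [Polynomial.eval₂_map, ← hPp]
  congr 1
  ext y
  exact congrArg _ (hx.aeval_repr y)

end Integrality

section MinimalPolynomial

/-- The minimal polynomial of a constant of a derivation has constant coefficients. -/
theorem exists_monic_root_derivation_coeff_eq_zero {R B : Type*} [CommRing R] [IsDomain R]
    [IsIntegrallyClosed R] [Algebra ℂ R] [CommRing B] [IsDomain B] [Algebra ℂ B] (φ : R →+* B)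
    (hφ : Function.Injective φ) (D : Derivation ℂ R R) (D' : Derivation ℂ B B)
    (hD : ∀ r, D' (φ r) = φ (D r)) {b : B} (hb : φ.IsIntegralElem b) (hb0 : D' b = 0) :
    ∃ p : Polynomial R, p.Monic ∧ p.eval₂ φ b = 0 ∧ ∀ i, D (p.coeff i) = 0 := by
  let : Algebra R B := φ.toAlgebra
  have hfaith : FaithfulSMul R B := (faithfulSMul_iff_algebraMap_injective R B).mpr hφ
  have hint : IsIntegral R b := hb
  set p := minpoly R b with hp
  have hmonic : p.Monic := minpoly.monic hint
  have hroot : p.eval₂ φ b = 0 := minpoly.aeval R b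
  have hpow : ∀ i : ℕ, D' (b ^ i) = 0 := fun i => by rw [D'.leibniz_pow, hb0]; simp
  let p' : Polynomial R :=
    ∑ i ∈ Finset.range p.natDegree, Polynomial.C (D (p.coeff i)) * Polynomial.X ^ i
  have hp'root : Polynomial.aeval b p' = 0 := by
    have h := congrArg D' hroot
    rw [Polynomial.eval₂_eq_sum_range, Finset.sum_range_succ, hmonic.coeff_natDegree, map_add,
      map_sum] at h
    simp only [D'.leibniz, hpow, hD, map_one, map_zero, one_mul, add_zero,
      smul_eq_mul] at h
    simp only [p', map_sum, map_mul, Polynomial.aeval_C, map_pow, Polynomial.aeval_X]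
    rw [← h]
    exact Finset.sum_congr rfl fun i _ => by rw [mul_zero, zero_add, mul_comm]; rfl
  have hp'0 : p' = 0 := by
    by_contra hne
    have h1 := minpoly.IsIntegrallyClosed.degree_le_of_ne_zero hne hp'root
    have h2 : p'.degree < p.degree := by
      rw [Polynomial.degree_eq_natDegree hmonic.ne_zero]
      exact Polynomial.degree_sum_fin_lt
        (fun i : Fin p.natDegree => D (p.coeff i)) |>.trans_eq' (by
          simp only [p', Finset.sum_range])
    exact absurd h1 (not_le.mpr h2)
  refine ⟨p, hmonic, hroot, fun i => ?_⟩
  rcases lt_trichotomy i p.natDegree with hi | rfl | hi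
  · have h := congrArg (fun r => Polynomial.coeff r i) hp'0
    simpa [p', Polynomial.finsetSum_coeff, Polynomial.coeff_X_pow, hi] using h
  · rw [hmonic.coeff_natDegree, D.map_one_eq_zero]
  · rw [Polynomial.coeff_eq_zero_of_natDegree_lt hi, map_zero]

end MinimalPolynomial

section KeyVanishing

theorem isWeightedHomogeneous_aeval {τ ρ : Type*} [Fintype τ] {w : τ → ℤ} {w' : ρ → ℤ} {e n : ℤ}
    {x : τ → MvPolynomial ρ ℂ} (hx : ∀ i, (x i).IsWeightedHomogeneous w' (e * w i))
    {p : MvPolynomial τ ℂ} (hp : p.IsWeightedHomogeneous w n) :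
    (aeval x p).IsWeightedHomogeneous w' (e * n) := by
  induction hp using IsWeightedHomogeneous.induction_on with
  | zero => rw [map_zero]; exact isWeightedHomogeneous_zero _ _ _
  | add p q hp hq h1 h2 => rw [map_add]; exact h1.add h2
  | monomial d r hr =>
    rw [aeval_monomial, Finsupp.prod_fintype _ _ (by simp)]
    refine IsWeightedHomogeneous.C_mul ?_ r
    have := IsWeightedHomogeneous.prod Finset.univ (fun i => x i ^ d i) _
      fun i _ => (hx i).pow (d i)
    convert this using 1
    rw [← hr, Finsupp.weight_apply, Finsupp.sum_fintype _ _ (by simp), Finset.mul_sum]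
    exact Finset.sum_congr rfl fun i _ => by simp only [nsmul_eq_mul]; ring

variable {σ : Type*}

theorem leftDer_rename_inr (f : σ → MvPolynomial (σ ⊕ σ) ℂ) (g : MvPolynomial σ ℂ) :
    leftDer f (rename Sum.inr g) = 0 := by
  classical
  refine derivation_eq_zero_of_forall_mem_vars fun j hj => ?_
  obtain ⟨j, -, rfl⟩ := Finset.mem_image.mp (vars_rename _ _ hj)
  simp [leftDer]

variable [Fintype σ]

theorem isWeightedHomogeneous_rename_inr {g : MvPolynomial σ ℂ} {n : ℕ} (hg : g.IsHomogeneous n)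
    (u : σ → ℤ) : (rename Sum.inr g : MvPolynomial (σ ⊕ σ) ℂ).IsWeightedHomogeneous
      (Sum.elim u fun _ => 1) (n : ℤ) := by
  have hg' : g.IsWeightedHomogeneous (fun _ : σ => (1 : ℤ)) n := fun d hd => by
    rw [← hg hd]
    simp [Finsupp.weight_apply, Finsupp.sum]
  rw [rename_eq_aeval]
  simpa using isWeightedHomogeneous_aeval (e := 1) (w' := Sum.elim u fun _ => 1)
    (x := X ∘ Sum.inr)
    (fun j => by simpa using isWeightedHomogeneous_X ℂ (Sum.elim u fun _ => 1) (Sum.inr j)) hg'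

/-- A constant of `∑ᵢ fᵢ(x) ∂/∂bᵢ` whose `x`-degree is smaller than `e` times its `b`-degree
vanishes, if the `fᵢ` are homogeneous of degree `e` with the origin as only common zero. -/
theorem eq_zero_of_leftDer_eq_zero {f : σ → MvPolynomial σ ℂ} {e : ℕ} (he : 0 < e)
    (hf : ∀ i, (f i).IsHomogeneous e) (hzero : ∀ x : σ → ℂ, (∀ i, eval x (f i) = 0) → x = 0)
    {h : MvPolynomial (σ ⊕ σ) ℂ} {n : ℤ} (hn : n < 0)
    (hh : h.IsWeightedHomogeneous (Sum.elim (fun _ => -(e : ℤ)) (fun _ => 1)) n)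
    (hE : leftDer (fun i => rename Sum.inr (f i)) h = 0) : h = 0 := by
  classical
  set w : σ ⊕ σ → ℤ := Sum.elim (fun _ => -(e : ℤ)) (fun _ => 1) with hw
  set φ : MvPolynomial (σ ⊕ σ) ℂ →ₐ[ℂ] MvPolynomial (σ ⊕ σ) ℂ := aeval (leftVarsAnd f) with hφ
  have hφE : ∀ r, leftDer (fun i => rename Sum.inr (f i)) (φ r) =
      φ (leftDer (fun i => X (Sum.inr i)) r) := fun r => by
    induction r using MvPolynomial.induction_on with
    | C a => simp [φ]
    | add p q hp hq => simp only [map_add, hp, hq]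
    | mul_X p i hp =>
      rcases i with i | i
      · simp only [map_mul, Derivation.leibniz, smul_eq_mul, map_add, hp]
        simp [φ, leftDer, leftVarsAnd]
      · simp only [map_mul, Derivation.leibniz, smul_eq_mul, map_add, hp]
        simp [φ, leftVarsAnd, leftDer_rename_inr]
        simp [leftDer]
  obtain ⟨p, hmonic, hroot, hcoeff⟩ := exists_monic_root_derivation_coeff_eq_zero φ.toRingHom
    (algebraicIndependent_leftVarsAnd he hf hzero) _ _ hφE
    (isIntegralElem_aeval_leftVarsAnd he hf hzero h) hE
  have hvars : ∀ i, (leftVarsAnd f i).IsWeightedHomogeneous w (e * polWeight σ i) := by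
    rintro (i | i)
    · simpa [leftVarsAnd, polWeight, w] using isWeightedHomogeneous_X ℂ w (Sum.inl i)
    · simpa [leftVarsAnd, polWeight] using isWeightedHomogeneous_rename_inr (hf i) _
  have hlower : ∀ i < p.natDegree, weightedHomogeneousComponent w (p.natDegree • n)
      (φ.toRingHom (p.coeff i) * h ^ i) = 0 := fun i hi => by
    change weightedHomogeneousComponent w _ (φ (p.coeff i) * h ^ i) = 0
    obtain ⟨t, ht⟩ := eq_sum_weightedHomogeneousComponent (polWeight σ) (p.coeff i)
    rw [ht, map_sum, Finset.sum_mul, map_sum]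
    refine Finset.sum_eq_zero fun l _ => ?_
    rcases lt_or_ge l 0 with hl | hl
    · rw [weightedHomogeneousComponent_eq_zero_of_polarization (hcoeff i) hl]
      simp
    · refine IsWeightedHomogeneous.weightedHomogeneousComponent_ne _
        ((isWeightedHomogeneous_aeval hvars
          (weightedHomogeneousComponent_isWeightedHomogeneous l _)).mul (hh.pow i)) (ne_of_lt ?_)
      have hi' : (i : ℤ) < p.natDegree := by exact_mod_cast hi
      have hel : 0 ≤ (e : ℤ) * l := by positivity
      simp only [nsmul_eq_mul]
      nlinarith
  have hcomp := congrArg (weightedHomogeneousComponent w (p.natDegree • n)) hroot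
  rw [Polynomial.eval₂_eq_sum_range, Finset.sum_range_succ, hmonic.coeff_natDegree, map_one,
    one_mul, map_add, map_sum, map_zero, weightedHomogeneousComponent_eq_self (hh.pow _),
    Finset.sum_eq_zero (fun i hi => hlower i (Finset.mem_range.mp hi)), zero_add] at hcomp
  exact eq_zero_of_pow_eq_zero hcomp

end KeyVanishing

section CoefficientDerivation

variable {R : Type*} [CommRing R] [Algebra ℂ R]

/-- The derivation of `R[X]` applying a derivation of `R` to every coefficient. -/
def coeffDer (D : Derivation ℂ R R) : Derivation ℂ (Polynomial R) (Polynomial R) :=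
  PolynomialModule.equivPolynomialSelf.toLinearMap.compDer D.mapCoeffs

theorem coeff_coeffDer (D : Derivation ℂ R R) (p : Polynomial R) (n : ℕ) :
    (coeffDer D p).coeff n = D (p.coeff n) := rfl

theorem coeffDer_C (D : Derivation ℂ R R) (a : R) :
    coeffDer D (Polynomial.C a) = Polynomial.C (D a) := by
  ext n
  rw [coeff_coeffDer, Polynomial.coeff_C, Polynomial.coeff_C]
  split_ifs <;> simp

theorem coeffDer_X (D : Derivation ℂ R R) : coeffDer D Polynomial.X = 0 := by
  ext n
  rw [coeff_coeffDer, Polynomial.coeff_X]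
  split_ifs <;> simp

end CoefficientDerivation

section Remainder

variable {R : Type*} [CommRing R]

theorem monomial_modByMonic_X_pow_sub_C [Nontrivial R] {d : ℕ} (hd : 0 < d) (a c : R) (n : ℕ) :
    Polynomial.monomial n c %ₘ (Polynomial.X ^ d - Polynomial.C a) =
      Polynomial.monomial (n % d) (c * a ^ (n / d)) := by
  have hmonic := Polynomial.monic_X_pow_sub_C a hd.ne'
  obtain ⟨q, hq⟩ := sub_dvd_pow_sub_pow (Polynomial.X ^ d) (Polynomial.C a) (n / d)
  refine (Polynomial.div_modByMonic_unique
    (Polynomial.C c * Polynomial.X ^ (n % d) * q) _ hmonic ⟨?_, ?_⟩).2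
  · have hX : (Polynomial.X : Polynomial R) ^ n =
        (Polynomial.X ^ d) ^ (n / d) * Polynomial.X ^ (n % d) := by
      rw [← pow_mul, ← pow_add, Nat.div_add_mod]
    rw [← Polynomial.C_mul_X_pow_eq_monomial, ← Polynomial.C_mul_X_pow_eq_monomial, hX,
      Polynomial.C_mul, Polynomial.C_pow]
    linear_combination -(Polynomial.C c * Polynomial.X ^ (n % d)) * hq
  · rw [Polynomial.degree_X_pow_sub_C hd]
    exact (Polynomial.degree_monomial_le _ _).trans_lt (by exact_mod_cast Nat.mod_lt n hd)

theorem coeff_modByMonic_X_pow_sub_C [Nontrivial R] {d : ℕ} (hd : 0 < d) (a : R)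
    (p : Polynomial R) (j : ℕ) :
    (p %ₘ (Polynomial.X ^ d - Polynomial.C a)).coeff j =
      ∑ n ∈ p.support, if n % d = j then p.coeff n * a ^ (n / d) else 0 := by
  conv_lhs => rw [p.as_sum_support, ← Polynomial.modByMonicHom_apply, map_sum]
  simp only [Polynomial.modByMonicHom_apply, monomial_modByMonic_X_pow_sub_C hd,
    Polynomial.finsetSum_coeff, Polynomial.coeff_monomial]

variable [Nontrivial R] [Algebra ℂ R]

/-- The remainder of a polynomial whose coefficientwise derivative is divisible by `X ^ d - a`,
for a constant `a`, has constant coefficients. -/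
theorem derivation_coeff_modByMonic_eq_zero {D : Derivation ℂ R R} {a : R} (ha : D a = 0) {d : ℕ}
    (hd : 0 < d) {p : Polynomial R}
    (hp : Polynomial.X ^ d - Polynomial.C a ∣ coeffDer D p) (j : ℕ) :
    D ((p %ₘ (Polynomial.X ^ d - Polynomial.C a)).coeff j) = 0 := by
  have hmonic := Polynomial.monic_X_pow_sub_C a hd.ne'
  set P := Polynomial.X ^ d - Polynomial.C a with hP
  have hDP : coeffDer D P = 0 := by
    rw [hP, map_sub, coeffDer_C, ha, Derivation.leibniz_pow, coeffDer_X]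
    simp
  have hdvd : P ∣ coeffDer D (p %ₘ P) := by
    have h := congrArg (coeffDer D) (Polynomial.modByMonic_add_div p P)
    rw [map_add, Derivation.leibniz, hDP, smul_zero, add_zero, smul_eq_mul] at h
    rw [eq_sub_of_add_eq h]
    exact dvd_sub hp (dvd_mul_right _ _)
  have hdeg : (coeffDer D (p %ₘ P)).degree < P.degree := by
    refine (Polynomial.degree_mono fun i hi => ?_).trans_lt
      (Polynomial.degree_modByMonic_lt p hmonic)
    rw [Polynomial.mem_support_iff] at hi ⊢
    exact fun h0 => hi (by rw [coeff_coeffDer, h0, map_zero])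
  have hzero : coeffDer D (p %ₘ P) = 0 := by
    by_contra h0
    exact hmonic.not_dvd_of_degree_lt h0 hdeg hdvd
  rw [← coeff_coeffDer, hzero, Polynomial.coeff_zero]

end Remainder

section GradedCoefficients

variable {ρ : Type*}

/-- Homogeneity of an element of `ℂ[ρ][X]` for a weight on `ρ` and weight `1` of `X`. -/
def HasGradedCoeffs (w : ρ → ℤ) (n : ℤ) (p : Polynomial (MvPolynomial ρ ℂ)) : Prop :=
  ∀ i : ℕ, (p.coeff i).IsWeightedHomogeneous w (n - i)

variable {w : ρ → ℤ} {n n' : ℤ} {p p' : Polynomial (MvPolynomial ρ ℂ)}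

theorem HasGradedCoeffs.add (hp : HasGradedCoeffs w n p) (hp' : HasGradedCoeffs w n p') :
    HasGradedCoeffs w n (p + p') := fun i => by
  rw [Polynomial.coeff_add]; exact (hp i).add (hp' i)

theorem HasGradedCoeffs.mul (hp : HasGradedCoeffs w n p) (hp' : HasGradedCoeffs w n' p') :
    HasGradedCoeffs w (n + n') (p * p') := fun i => by
  rw [Polynomial.coeff_mul]
  refine IsWeightedHomogeneous.sum _ _ _ fun x hx => ?_
  have h := (hp x.1).mul (hp' x.2)
  rwa [show n - x.1 + (n' - x.2) = n + n' - i by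
    rw [← Finset.HasAntidiagonal.mem_antidiagonal.mp hx]; push_cast; ring] at h

theorem HasGradedCoeffs.C {a : MvPolynomial ρ ℂ} (ha : a.IsWeightedHomogeneous w n) :
    HasGradedCoeffs w n (Polynomial.C a) := fun i => by
  rw [Polynomial.coeff_C]
  split_ifs with h
  · simpa [h] using ha
  · exact isWeightedHomogeneous_zero _ _ _

theorem HasGradedCoeffs.X : HasGradedCoeffs w 1 Polynomial.X := fun i => by
  rw [Polynomial.coeff_X]
  split_ifs with h
  · simpa [← h] using isWeightedHomogeneous_one ℂ w
  · exact isWeightedHomogeneous_zero _ _ _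

theorem HasGradedCoeffs.aeval {τ : Type*} {v : τ → ℤ}
    {x : τ → Polynomial (MvPolynomial ρ ℂ)} (hx : ∀ i, HasGradedCoeffs w (v i) (x i))
    {a : MvPolynomial τ ℂ} (ha : a.IsWeightedHomogeneous v n) :
    HasGradedCoeffs w n (aeval x a) := by
  have hconst : ∀ r : ℂ, HasGradedCoeffs w 0 (algebraMap ℂ _ r) := fun r =>
    HasGradedCoeffs.C (isWeightedHomogeneous_C w r)
  have hpow : ∀ (i : τ) (k : ℕ), HasGradedCoeffs w (k • v i) (x i ^ k) := fun i k => by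
    induction k with
    | zero => simpa using hconst 1
    | succ k ih => rw [pow_succ, succ_nsmul]; exact ih.mul (hx i)
  have hmon : ∀ (s : τ →₀ ℕ) (r : ℂ),
      HasGradedCoeffs w (Finsupp.weight v s) (MvPolynomial.aeval x (monomial s r)) := fun s => by
    induction s using Finsupp.induction_linear with
    | zero => intro r; simpa using hconst r
    | add s t hs ht =>
      intro r
      rw [map_add, ← mul_one r, ← monomial_mul, map_mul]
      exact (hs r).mul (ht 1)
    | single i k =>
      intro r
      rw [← C_mul_X_pow_eq_monomial, map_mul, aeval_C, map_pow, aeval_X, Finsupp.weight_single,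
        ← zero_add (k • v i)]
      exact (hconst r).mul (hpow i k)
  induction ha using IsWeightedHomogeneous.induction_on with
  | zero => rw [map_zero]; exact fun i => isWeightedHomogeneous_zero _ _ _
  | add p q hp hq h1 h2 => rw [map_add]; exact h1.add h2
  | monomial s r hr => rw [← hr]; exact hmon s r

end GradedCoefficients

section Chart

variable {N : ℕ}

theorem injective_inr_castSucc (N : ℕ) : Function.Injective
    (fun i : Fin N => (Sum.inr i.castSucc : Fin (N + 1) ⊕ Fin (N + 1))) :=
  Sum.inr_injective.comp (Fin.castSucc_injective N)

/-- The chart `Y = (X_N b, -b·x)`, `X = (x, X_N)` of the hypersurface `q = 0`, with coordinates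
`b`, `x` and the polynomial variable `X_N`. -/
def chart (N : ℕ) : S N →ₐ[ℂ] Polynomial (MvPolynomial (Fin N ⊕ Fin N) ℂ) :=
  aeval (Sum.elim
    (Fin.snoc (α := fun _ => Polynomial (MvPolynomial (Fin N ⊕ Fin N) ℂ))
      (fun i => Polynomial.X * Polynomial.C (X (Sum.inl i)))
      (-∑ i, Polynomial.C (X (Sum.inl i) * X (Sum.inr i))))
    (Fin.snoc (α := fun _ => Polynomial (MvPolynomial (Fin N ⊕ Fin N) ℂ))
      (fun i => Polynomial.C (X (Sum.inr i))) Polynomial.X))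

theorem chart_Y_castSucc (i : Fin N) : chart N (X (Sum.inl i.castSucc)) =
    Polynomial.X * Polynomial.C (X (Sum.inl i)) := by simp [chart]

theorem chart_Y_last : chart N (X (Sum.inl (Fin.last N))) =
    -∑ i, Polynomial.C (X (Sum.inl i) * X (Sum.inr i)) := by simp [chart]

theorem chart_X_castSucc (i : Fin N) : chart N (X (Sum.inr i.castSucc)) =
    Polynomial.C (X (Sum.inr i)) := by simp [chart]

theorem chart_X_last : chart N (X (Sum.inr (Fin.last N))) = Polynomial.X := by simp [chart]

theorem chart_rename (G : MvPolynomial (Fin N) ℂ) :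
    chart N (rename (fun i => Sum.inr i.castSucc) G) = Polynomial.C (rename Sum.inr G) := by
  have h : (chart N).comp (rename fun i => Sum.inr i.castSucc) =
      Polynomial.CAlgHom.comp (rename Sum.inr) := by
    refine algHom_ext fun i => ?_
    simp [chart_X_castSucc]
  exact DFunLike.congr_fun h G

theorem chart_qPoly : chart N (qPoly N) = 0 := by
  simp only [qPoly, Fin.sum_univ_castSucc, map_add, map_sum, map_mul, chart_Y_castSucc,
    chart_Y_last, chart_X_castSucc, chart_X_last]
  have h : ∀ i : Fin N, Polynomial.C (X (Sum.inr i)) * (Polynomial.X * Polynomial.C (X (Sum.inl i)))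
      = Polynomial.X * (Polynomial.C (X (Sum.inl i)) * Polynomial.C (X (Sum.inr i)) :
        Polynomial (MvPolynomial (Fin N ⊕ Fin N) ℂ)) := fun i => by ring
  rw [Finset.sum_congr rfl fun i _ => h i, ← Finset.mul_sum]
  ring

/-- The inverse of the chart where `X_N` is invertible, up to scaling the `Y`-variables. -/
def unchart (N : ℕ) : Polynomial (MvPolynomial (Fin N ⊕ Fin N) ℂ) →ₐ[ℂ] S N :=
  Polynomial.eval₂AlgHom (rename (Sum.map Fin.castSucc Fin.castSucc)) (X (Sum.inr (Fin.last N)))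
    fun _ => Commute.all _ _

theorem unchart_X : unchart N Polynomial.X = X (Sum.inr (Fin.last N)) := by
  simp [unchart]

theorem unchart_C (a : MvPolynomial (Fin N ⊕ Fin N) ℂ) :
    unchart N (Polynomial.C a) = rename (Sum.map Fin.castSucc Fin.castSucc) a := by
  simp [unchart]

theorem aeval_scale_Y {m : ℕ} {A : S N} (hA : A.IsWeightedHomogeneous (wY N) m) (t : S N) :
    aeval (fun v => t ^ wY N v * X v) A = t ^ m * A := by
  induction hA using IsWeightedHomogeneous.induction_on with
  | zero => simp
  | add p q hp hq h1 h2 => rw [map_add, h1, h2, mul_add]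
  | monomial s r hr =>
    rw [aeval_monomial, monomial_eq, algebraMap_eq, ← hr, Finsupp.weight_apply]
    simp only [mul_pow, Finsupp.prod, Finsupp.sum, ← pow_mul,
      Finset.prod_mul_distrib, Finset.prod_pow_eq_pow_sum, smul_eq_mul, mul_comm (wY N _)]
    ring

theorem unchart_chart_sub_mem {m : ℕ} {A : S N} (hA : A.IsWeightedHomogeneous (wY N) m)
    {I : Ideal (S N)} (hI : qPoly N ∈ I) :
    unchart N (chart N A) - X (Sum.inr (Fin.last N)) ^ m * A ∈ I := by
  rw [← aeval_scale_Y hA, ← Ideal.Quotient.eq]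
  have h : (Ideal.Quotient.mkₐ ℂ I).comp ((unchart N).comp (chart N)) =
      (Ideal.Quotient.mkₐ ℂ I).comp (aeval fun v => X (Sum.inr (Fin.last N)) ^ wY N v * X v) := by
    refine algHom_ext fun v => ?_
    simp only [AlgHom.comp_apply, aeval_X, Ideal.Quotient.mkₐ_eq_mk]
    rcases v with i | i <;> refine Fin.lastCases ?_ (fun i => ?_) i
    · rw [Ideal.Quotient.eq, chart_Y_last]
      convert I.neg_mem hI using 1
      simp only [qPoly, wY, Sum.elim_inl, Fin.sum_univ_castSucc, map_neg, map_sum, unchart_C,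
        map_mul, rename_X, Sum.map_inl, Sum.map_inr, pow_one, neg_add, mul_comm (X (Sum.inl _))]
      ring
    · rw [chart_Y_castSucc, map_mul, unchart_X, unchart_C]
      simp [wY]
    · simp [chart_X_last, unchart_X, wY]
    · simp [chart_X_castSucc, unchart_C, wY]
  exact DFunLike.congr_fun h A

theorem unchart_X_pow_sub_C (d : ℕ) (G : MvPolynomial (Fin N) ℂ) :
    unchart N (Polynomial.X ^ d - Polynomial.C (rename Sum.inr G)) =
      X (Sum.inr (Fin.last N)) ^ d - rename (fun i => Sum.inr i.castSucc) G := by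
  rw [map_sub, map_pow, unchart_X, unchart_C, rename_rename]
  rfl

theorem hasGradedCoeffs_chart {e m k : ℕ} {A : S N} (hA : Bihom N m k A) :
    HasGradedCoeffs (Sum.elim (fun _ => -(e : ℤ)) (fun _ => 1)) ((1 - e) * m + k) (chart N A) := by
  set w : Fin N ⊕ Fin N → ℤ := Sum.elim (fun _ => -(e : ℤ)) (fun _ => 1) with hw
  have hA' : A.IsWeightedHomogeneous (fun v => (1 - (e : ℤ)) * wY N v + wX N v)
      ((1 - e) * m + k) := fun s hs => by
    rw [← hA.1 hs, ← hA.2 hs]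
    simp only [Finsupp.weight_apply, Finsupp.sum, smul_eq_mul, nsmul_eq_mul]
    push_cast
    rw [Finset.mul_sum, ← Finset.sum_add_distrib]
    exact Finset.sum_congr rfl fun i _ => by ring
  refine HasGradedCoeffs.aeval (fun v => ?_) hA'
  have hb := fun i : Fin N => isWeightedHomogeneous_X ℂ w (Sum.inl i)
  have hx := fun i : Fin N => isWeightedHomogeneous_X ℂ w (Sum.inr i)
  rcases v with i | i <;> refine Fin.lastCases ?_ (fun i => ?_) i
  · have h : (-∑ i : Fin N, X (Sum.inl i) * X (Sum.inr i) :
        MvPolynomial (Fin N ⊕ Fin N) ℂ).IsWeightedHomogeneous w (-e + 1) :=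
      (weightedHomogeneousSubmodule ℂ w _).neg_mem
        (IsWeightedHomogeneous.sum _ _ _ fun i _ => (hb i).mul (hx i))
    have := HasGradedCoeffs.C h
    simpa [wY, wX, add_comm, sub_eq_add_neg] using this
  · simpa [wY, wX, w, sub_eq_add_neg] using HasGradedCoeffs.X.mul (HasGradedCoeffs.C (hb i))
  · simpa [wY, wX] using HasGradedCoeffs.X (w := w)
  · simpa [wY, wX, w] using HasGradedCoeffs.C (hx i)

/-- In the chart, `∑ᵢ (∂P/∂Xᵢ) ∂/∂Yᵢ` becomes `∑ᵢ (∂G/∂xᵢ) ∂/∂bᵢ` modulo `P`, up to the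
factor `-X_N`. -/
theorem coeffDer_chart {d : ℕ} (hd : 0 < d) {G : MvPolynomial (Fin N) ℂ} (hG : G.IsHomogeneous d)
    (A : S N) :
    coeffDer (leftDer fun i => rename Sum.inr (pderiv i G)) (chart N A) =
      (Polynomial.X ^ d - Polynomial.C (rename Sum.inr G)) *
          ((d : Polynomial _) * chart N (pderiv (Sum.inl (Fin.last N)) A)) -
        Polynomial.X * chart N (∑ i : Fin (N + 1), pderiv (Sum.inr i)
          (X (Sum.inr (Fin.last N)) ^ d - rename (fun i => Sum.inr i.castSucc) G) *
            pderiv (Sum.inl i) A) := by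
  set D := leftDer fun i => rename Sum.inr (pderiv i G) with hD
  have hDb : ∀ i, D (X (Sum.inl i)) = rename Sum.inr (pderiv i G) := fun i => by simp [D, leftDer]
  have hDx : ∀ i, D (X (Sum.inr i)) = 0 := fun i => by simp [D, leftDer]
  have hY : ∀ i : Fin N, coeffDer D (chart N (X (Sum.inl i.castSucc))) =
      Polynomial.X * Polynomial.C (rename Sum.inr (pderiv i G)) := fun i => by
    rw [chart_Y_castSucc, Derivation.leibniz, coeffDer_C, coeffDer_X, hDb, smul_zero, add_zero,
      smul_eq_mul]
  have hYlast : coeffDer D (chart N (X (Sum.inl (Fin.last N)))) =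
      -((d : Polynomial _) * Polynomial.C (rename Sum.inr G)) := by
    have hEuler := congrArg (rename (Sum.inr : Fin N → Fin N ⊕ Fin N)) hG.sum_X_mul_pderiv
    simp only [map_sum, map_mul, rename_X, map_nsmul] at hEuler
    rw [chart_Y_last, ← map_sum, map_neg, coeffDer_C, map_sum]
    simp only [Derivation.leibniz, hDb, hDx, smul_eq_mul, mul_zero, zero_add]
    rw [hEuler, map_nsmul, nsmul_eq_mul]
  have hX : ∀ i : Fin (N + 1), coeffDer D (chart N (X (Sum.inr i))) = 0 := fun i => by
    refine Fin.lastCases ?_ (fun i => ?_) i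
    · rw [chart_X_last, coeffDer_X]
    · rw [chart_X_castSucc, coeffDer_C, hDx, map_zero]
  have hP : ∀ i : Fin N, pderiv (Sum.inr i.castSucc)
      (X (Sum.inr (Fin.last N)) ^ d - rename (fun i => Sum.inr i.castSucc) G : S N) =
        -rename (fun i => Sum.inr i.castSucc) (pderiv i G) := fun i => by
    rw [map_sub, pderiv_rename (injective_inr_castSucc N) i G, pderiv_pow, pderiv_X_of_ne,
      mul_zero, zero_sub]
    simp [Fin.ext_iff, i.isLt.ne']
  have hPlast : pderiv (Sum.inr (Fin.last N))
      (X (Sum.inr (Fin.last N)) ^ d - rename (fun i => Sum.inr i.castSucc) G : S N) =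
        (d : S N) * X (Sum.inr (Fin.last N)) ^ (d - 1) := by
    rw [map_sub, pderiv_pow, pderiv_X_self, mul_one, pderiv_eq_zero_of_notMem_vars, sub_zero]
    intro hmem
    obtain ⟨i, -, hi⟩ := Finset.mem_image.mp (vars_rename _ _ hmem)
    simp [Fin.ext_iff, i.isLt.ne] at hi
  have hchain := derivation_aeval (coeffDer D) (chart N ∘ X) A
  rw [← aeval_unique (chart N), Fintype.sum_sum_type] at hchain
  simp only [Function.comp_apply, hX, mul_zero, Finset.sum_const_zero, add_zero,
    Fin.sum_univ_castSucc, hY, hYlast] at hchain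
  rw [hchain, Fin.sum_univ_castSucc, hPlast]
  simp only [hP, map_add, map_sum, map_mul, map_neg, chart_rename, map_pow, chart_X_last,
    map_natCast]
  obtain ⟨e, rfl⟩ : ∃ e, d = e + 1 := ⟨d - 1, by omega⟩
  rw [mul_add, Finset.mul_sum, add_tsub_cancel_right]
  have hterm : ∀ i : Fin N, Polynomial.X * (-Polynomial.C (rename Sum.inr (pderiv i G)) *
      chart N (pderiv (Sum.inl i.castSucc) A)) = -(chart N (pderiv (Sum.inl i.castSucc) A) *
        (Polynomial.X * Polynomial.C (rename Sum.inr (pderiv i G)))) := fun i => by ring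
  rw [Finset.sum_congr rfl fun i _ => hterm i, Finset.sum_neg_distrib]
  ring

end Chart

section Cancellation

variable {N : ℕ}

/-- The quadric `∑ᵢ Xᵢ Yᵢ` with the last summand left out. -/
def truncatedQuadric (N : ℕ) : S N :=
  ∑ i : Fin N, X (Sum.inr i.castSucc) * X (Sum.inl i.castSucc)

theorem prime_truncatedQuadric (hN : 2 ≤ N) : Prime (truncatedQuadric N) := by
  classical
  let c : Fin (N + 1) →₀ ℂ := Finsupp.onFinset Finset.univ
    (Fin.snoc (α := fun _ => ℂ) (fun _ => 1) 0) (by simp)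
  have hc : ∀ i : Fin N, c i.castSucc = 1 := fun i => by simp [c]
  have hclast : c (Fin.last N) = 0 := by simp [c]
  have heq : truncatedQuadric N = sumSMulXSMulY c := by
    rw [sumSMulXSMulY, Finsupp.linearCombination_apply, Finsupp.sum_fintype _ _ (by simp),
      Fin.sum_univ_castSucc, hclast, zero_smul, add_zero, truncatedQuadric]
    exact Finset.sum_congr rfl fun i _ => by rw [hc, one_smul, mul_comm]
  rw [heq]
  refine (irreducible_sumSMulXSMulY c ?_ fun r hr => ?_).prime
  · refine ⟨(⟨0, by omega⟩ : Fin N).castSucc, ?_, (⟨1, by omega⟩ : Fin N).castSucc, ?_, ?_⟩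
    · rw [SetLike.mem_coe, Finsupp.mem_support_iff, hc]
      exact one_ne_zero
    · rw [SetLike.mem_coe, Finsupp.mem_support_iff, hc]
      exact one_ne_zero
    · simp
  · exact isUnit_of_dvd_one (hc ⟨0, by omega⟩ ▸ hr _)

/-- Setting `X_N = 0`. -/
def killLast (N : ℕ) : S N →ₐ[ℂ] S N :=
  aeval fun v => if v = Sum.inr (Fin.last N) then 0 else X v

theorem X_last_dvd_sub_killLast (a : S N) : X (Sum.inr (Fin.last N)) ∣ a - killLast N a := by
  rw [← Ideal.mem_span_singleton, ← Ideal.Quotient.eq]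
  set J : Ideal (S N) := Ideal.span {X (Sum.inr (Fin.last N))} with hJ
  have h : Ideal.Quotient.mkₐ ℂ J = (Ideal.Quotient.mkₐ ℂ J).comp (killLast N) := by
    refine algHom_ext fun v => ?_
    by_cases hv : v = Sum.inr (Fin.last N)
    · simp [hv, killLast, J]
    · simp [hv, killLast]
  exact DFunLike.congr_fun h a

theorem killLast_rename (G : MvPolynomial (Fin N) ℂ) :
    killLast N (rename (fun i => Sum.inr i.castSucc) G) =
      rename (fun i => Sum.inr i.castSucc) G := by
  have h : (killLast N).comp (rename fun i => Sum.inr i.castSucc) =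
      (rename fun i => Sum.inr i.castSucc : MvPolynomial (Fin N) ℂ →ₐ[ℂ] S N) := by
    refine algHom_ext fun i => ?_
    simp [killLast, Fin.ext_iff, i.isLt.ne]
  exact DFunLike.congr_fun h G

theorem killLast_qPoly : killLast N (qPoly N) = truncatedQuadric N := by
  simp only [qPoly, truncatedQuadric, Fin.sum_univ_castSucc, map_add, map_sum, map_mul]
  simp [killLast, Fin.ext_iff, fun i : Fin N => i.isLt.ne]

theorem not_truncatedQuadric_dvd_rename {G : MvPolynomial (Fin N) ℂ} (hG : G ≠ 0) :
    ¬ truncatedQuadric N ∣ rename (fun i => Sum.inr i.castSucc) G := by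
  rintro ⟨c, hc⟩
  let ψ : S N →ₐ[ℂ] S N := aeval (Sum.elim 0 fun i => X (Sum.inr i))
  have h := congrArg ψ hc
  have hq : ψ (truncatedQuadric N) = 0 := by simp [ψ, truncatedQuadric]
  rw [map_mul, hq, zero_mul] at h
  have hcomp : ψ.comp (rename fun i => Sum.inr i.castSucc) =
      (rename fun i => Sum.inr i.castSucc : MvPolynomial (Fin N) ℂ →ₐ[ℂ] S N) :=
    algHom_ext fun i => by simp [ψ]
  have h' : rename (fun i : Fin N => (Sum.inr i.castSucc : Fin (N + 1) ⊕ Fin (N + 1))) G = 0 :=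
    (DFunLike.congr_fun hcomp G).symm.trans h
  exact hG (rename_injective _ (injective_inr_castSucc N)
    (h'.trans (map_zero _).symm))

/-- `X_N` is not a zero divisor modulo `X_N ^ d - G(X₀,…,X_{N-1})` and `q`. -/
theorem mem_of_X_last_mul_mem (hN : 2 ≤ N) {d : ℕ} (hd : 0 < d) {G : MvPolynomial (Fin N) ℂ}
    (hG : G ≠ 0) {A : S N}
    (hA : X (Sum.inr (Fin.last N)) * A ∈ Ideal.span
      {X (Sum.inr (Fin.last N)) ^ d - rename (fun i => Sum.inr i.castSucc) G, qPoly N}) :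
    A ∈ Ideal.span
      {X (Sum.inr (Fin.last N)) ^ d - rename (fun i => Sum.inr i.castSucc) G, qPoly N} := by
  rw [Ideal.mem_span_pair] at hA ⊢
  obtain ⟨a, b, hab⟩ := hA
  have hkill := congrArg (killLast N) hab
  have hkX : killLast N (X (Sum.inr (Fin.last N))) = 0 := by simp [killLast]
  have hqt : qPoly N = truncatedQuadric N +
      X (Sum.inr (Fin.last N)) * X (Sum.inl (Fin.last N)) := by
    rw [qPoly, Fin.sum_univ_castSucc, truncatedQuadric]
  simp only [map_add, map_mul, map_sub, map_pow, hkX, killLast_rename, killLast_qPoly,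
    zero_pow hd.ne', zero_sub, zero_mul] at hkill
  obtain ⟨a', ha'⟩ := X_last_dvd_sub_killLast a
  obtain ⟨b', hb'⟩ := X_last_dvd_sub_killLast b
  set F : S N := rename (fun i => Sum.inr i.castSucc) G with hF
  have hprime := prime_truncatedQuadric hN
  have hdvd : truncatedQuadric N ∣ killLast N a * F :=
    ⟨killLast N b, by linear_combination -hkill⟩
  obtain ⟨c, hc⟩ := (hprime.dvd_or_dvd hdvd).resolve_right (not_truncatedQuadric_dvd_rename hG)
  have hb : killLast N b = F * c := by
    refine mul_left_cancel₀ hprime.ne_zero ?_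
    rw [hc] at hkill
    linear_combination hkill
  obtain ⟨e, rfl⟩ : ∃ e, d = e + 1 := ⟨d - 1, by omega⟩
  refine ⟨a' - c * X (Sum.inl (Fin.last N)), b' + c * X (Sum.inr (Fin.last N)) ^ e, ?_⟩
  refine mul_left_cancel₀ (X_ne_zero (Sum.inr (Fin.last N))) ?_
  rw [← hab, eq_add_of_sub_eq ha', eq_add_of_sub_eq hb', hc, hb, hqt]
  ring

end Cancellation

section Main

theorem isHomogeneous_of_rename {N d : ℕ} {G : MvPolynomial (Fin N) ℂ}
    (hG : (rename (fun i => Sum.inr i.castSucc) G : S N).IsWeightedHomogeneous (wX N) d) :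
    G.IsHomogeneous d := fun s hs => by
  have h := hG (d := s.mapDomain fun i => Sum.inr i.castSucc)
    (by rwa [coeff_rename_mapDomain _ (injective_inr_castSucc N)])
  rw [← h, Finsupp.weight_apply, Finsupp.weight_apply,
    Finsupp.sum_mapDomain_index_inj (injective_inr_castSucc N)]
  rfl

theorem X_pow_sub_C_dvd_chart {N d m k : ℕ} (hd : 3 ≤ d) {G : MvPolynomial (Fin N) ℂ}
    (hG : G.IsHomogeneous d)
    (hsmooth : ∀ x : Fin N → ℂ, (∀ i, eval x (pderiv i G) = 0) → x = 0)
    (hmk : m * (d - 2) > k) {A : S N} (hA : Bihom N m k A)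
    (hdel : (∑ i : Fin (N + 1), pderiv (Sum.inr i)
        (X (Sum.inr (Fin.last N)) ^ d - rename (fun i => Sum.inr i.castSucc) G) *
          pderiv (Sum.inl i) A) ∈
      Ideal.span {X (Sum.inr (Fin.last N)) ^ d - rename (fun i => Sum.inr i.castSucc) G,
        qPoly N}) :
    Polynomial.X ^ d - Polynomial.C (rename Sum.inr G) ∣ chart N A := by
  have hd0 : 0 < d := by omega
  have hmonic := Polynomial.monic_X_pow_sub_C
    (rename Sum.inr G : MvPolynomial (Fin N ⊕ Fin N) ℂ) hd0.ne'
  have hdvd : Polynomial.X ^ d - Polynomial.C (rename Sum.inr G) ∣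
      coeffDer (leftDer fun i => rename Sum.inr (pderiv i G)) (chart N A) := by
    obtain ⟨a, b, hab⟩ := Ideal.mem_span_pair.mp hdel
    rw [coeffDer_chart hd0 hG, ← hab, map_add, map_mul, map_mul, chart_qPoly, mul_zero, add_zero,
      map_sub, map_pow, chart_X_last, chart_rename]
    exact dvd_sub (dvd_mul_right _ _) (Dvd.intro_left _ (by rw [mul_assoc]))
  rw [← Polynomial.modByMonic_eq_zero_iff_dvd hmonic]
  ext1 j
  refine eq_zero_of_leftDer_eq_zero (e := d - 1) (by omega) (fun i => hG.pderiv) hsmooth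
    (n := (1 - (d - 1 : ℕ)) * m + k - j) ?_ ?_
    (derivation_coeff_modByMonic_eq_zero (leftDer_rename_inr _ G) hd0 hdvd j)
  · have hlt : (k : ℤ) < m * (d - 2 : ℕ) := by exact_mod_cast hmk
    push_cast [show 1 ≤ d by omega, show 2 ≤ d by omega] at hlt ⊢
    nlinarith
  · rw [coeff_modByMonic_X_pow_sub_C hd0]
    refine IsWeightedHomogeneous.sum _ _ _ fun n _ => ?_
    split_ifs with hn
    · have h := (hasGradedCoeffs_chart (e := d - 1) hA n).mul
        ((isWeightedHomogeneous_rename_inr hG _).pow (n / d))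
      convert h using 1
      have hdiv : ((n % d : ℕ) : ℤ) + d * (n / d : ℕ) = n := by exact_mod_cast Nat.mod_add_div n d
      rw [← hn, nsmul_eq_mul]
      linear_combination -hdiv
    · exact isWeightedHomogeneous_zero _ _ _

end Main

/-- For `P = X_N^d − F(X₀,…,X_{N−1})` with `F` homogeneous of degree `d ≥ 3`
whose partial derivatives only vanish simultaneously at the origin, and `I = (P, q)`:
if `A` is bihomogeneous of bidegree `(m, k)` with `m·(d−2) > k`, and
`∑ᵢ (∂P/∂Xᵢ)·(∂A/∂Yᵢ) ∈ I`, then `A ∈ I`. -/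
theorem statement1 (N : ℕ) (hN : 2 ≤ N) (d : ℕ) (hd : 3 ≤ d)
    (F : S N)
    (hFsupp : F ∈ MvPolynomial.supported ℂ
      (Set.range (fun i : Fin N => (Sum.inr i.castSucc : Fin (N + 1) ⊕ Fin (N + 1)))))
    (hFhom : F.IsWeightedHomogeneous (wX N) d)
    (hFsmooth : ∀ x : Fin N → ℂ,
      (∀ i : Fin N,
        eval (Sum.elim (fun _ => (0 : ℂ)) (Fin.snoc x 0))
          (pderiv (Sum.inr i.castSucc) F) = 0) → x = 0)
    (m k : ℕ) (hmk : m * (d - 2) > k)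
    (A : S N) (hA : Bihom N m k A)
    (hdel : (∑ i : Fin (N + 1),
        pderiv (Sum.inr i) (X (Sum.inr (Fin.last N)) ^ d - F) * pderiv (Sum.inl i) A) ∈
      Ideal.span {X (Sum.inr (Fin.last N)) ^ d - F, qPoly N}) :
    A ∈ Ideal.span {X (Sum.inr (Fin.last N)) ^ d - F, qPoly N} := by
  have hinj := injective_inr_castSucc N
  obtain ⟨G, rfl⟩ := exists_rename_eq_of_vars_subset_range F _ hinj (mem_supported.mp hFsupp)
  have hsmooth : ∀ x : Fin N → ℂ, (∀ i, eval x (pderiv i G) = 0) → x = 0 := fun x hx => by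
    refine hFsmooth x fun i => ?_
    rw [pderiv_rename hinj i G, eval_rename, ← hx i]
    congr 2
    ext j
    simp
  have hG0 : G ≠ 0 := by
    rintro rfl
    have h := congrFun (hsmooth (fun _ => 1) (by simp)) ⟨0, by omega⟩
    simp at h
  have hmem : X (Sum.inr (Fin.last N)) ^ m * A ∈ Ideal.span
      {X (Sum.inr (Fin.last N)) ^ d - rename (fun i => Sum.inr i.castSucc) G, qPoly N} := by
    obtain ⟨c, hc⟩ := X_pow_sub_C_dvd_chart hd (isHomogeneous_of_rename hFhom) hsmooth hmk hA hdel
    have h := unchart_chart_sub_mem hA.1 (Ideal.subset_span (Set.mem_insert_of_mem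
      (X (Sum.inr (Fin.last N)) ^ d - rename (fun i => Sum.inr i.castSucc) G)
      (Set.mem_singleton (qPoly N))))
    rw [hc, map_mul, unchart_X_pow_sub_C] at h
    refine (Submodule.sub_mem_iff_right _ ?_).mp h
    exact Ideal.mul_mem_right _ _ (Ideal.subset_span (Set.mem_insert _ _))
  clear hdel hmk hA
  induction m with
  | zero => simpa using hmem
  | succ m ih =>
    refine ih (mem_of_X_last_mul_mem hN (by omega) hG0 ?_)
    rwa [← mul_assoc, ← pow_succ']
end
end

section
/- Let d ≥ 2 and let F ∈ S be a polynomial in the X-variables X₀,…,X_{N−1} only (involving neither X_N nor any Yᵢ), homogeneous of degree d, such that the only common zero in ℂ^N of the partial derivatives ∂F/∂X₀,…,∂F/∂X_{N−1} is the origin. Set P := X_N^d − F. Then the ideal of S generated by P and q is a prime ideal. -/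
open MvPolynomial

noncomputable section

/-- An irreducible polynomial over an algebraically closed field cannot have its zero locus inside
a coordinate subspace of codimension two. -/
lemma MvPolynomial.exists_eval_eq_zero_of_irreducible {σ K : Type*} [Finite σ] [Field K]
    [IsAlgClosed K] {g : MvPolynomial σ K} (hg : Irreducible g) {i j : σ} (hij : i ≠ j) :
    ∃ x : σ → K, eval x g = 0 ∧ (x i ≠ 0 ∨ x j ≠ 0) := by
  by_contra! h
  have key : ∀ k : σ, (∀ x : σ → K, eval x g = 0 → x k = 0) → Associated g (X k) := by
    intro k hk
    have hmem : (X k : MvPolynomial σ K) ∈ vanishingIdeal K (zeroLocus K (Ideal.span {g})) := by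
      intro x hx
      simpa using hk x (by simpa [aeval_eq_eval] using hx g (Ideal.mem_span_singleton_self g))
    rw [vanishingIdeal_zeroLocus_eq_radical] at hmem
    obtain ⟨n, hn⟩ := hmem
    rw [Ideal.mem_span_singleton] at hn
    exact hg.associated_of_dvd X_prime.irreducible (hg.prime.dvd_of_dvd_pow hn)
  have hassoc : Associated (X i : MvPolynomial σ K) (X j) :=
    (key i fun x hx => (h x hx).1).symm.trans (key j fun x hx => (h x hx).2)
  exact hij (X_dvd_X.1 hassoc.dvd)

/-- If the partial derivatives of a polynomial in at least two variables vanish simultaneously only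
at the origin, then it is squarefree. -/
lemma MvPolynomial.squarefree_of_pderiv {σ K : Type*} [Finite σ] [Nontrivial σ] [Field K]
    [IsAlgClosed K] {F : MvPolynomial σ K}
    (hF : ∀ x : σ → K, (∀ i, eval x (pderiv i F) = 0) → x = 0) : Squarefree F := by
  have hF0 : F ≠ 0 := by
    rintro rfl
    exact one_ne_zero (hF 1 (by simp))
  rw [squarefree_iff_irreducible_sq_not_dvd_of_ne_zero hF0]
  rintro g hg ⟨h, rfl⟩
  obtain ⟨i, j, hij⟩ := exists_pair_ne σ
  obtain ⟨x, hx, hne⟩ := exists_eval_eq_zero_of_irreducible hg hij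
  have := hF x fun i => by simp [Derivation.leibniz, hx]
  simp [this] at hne

/-- By Eisenstein's criterion, `T ^ d - a` is irreducible for `a` a squarefree nonzero nonunit. -/
lemma Polynomial.irreducible_X_pow_sub_C_of_squarefree {R : Type*} [CommRing R] [IsDomain R]
    [UniqueFactorizationMonoid R] {a : R} (ha : Squarefree a) (ha0 : a ≠ 0) (hau : ¬IsUnit a)
    {d : ℕ} (hd : d ≠ 0) : Irreducible (Polynomial.X ^ d - Polynomial.C a : Polynomial R) := by
  obtain ⟨p, hp, hpa⟩ := WfDvdMonoid.exists_irreducible_factor hau ha0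
  have hmonic := Polynomial.monic_X_pow_sub_C a hd
  have hprime : (Ideal.span {p}).IsPrime := (Ideal.span_singleton_prime hp.ne_zero).2 hp.prime
  have hdeg := Polynomial.degree_X_pow_sub_C (Nat.pos_of_ne_zero hd) a
  refine Polynomial.irreducible_of_eisenstein_criterion hprime ?_ ?_ ?_ ?_ hmonic.isPrimitive
  · rw [hmonic.leadingCoeff]
    exact hprime.one_notMem
  · intro n hn
    rw [hdeg, Nat.cast_lt] at hn
    rw [Polynomial.coeff_sub, Polynomial.coeff_X_pow, if_neg hn.ne, zero_sub, neg_mem_iff,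
      Polynomial.coeff_C]
    split_ifs
    · exact Ideal.mem_span_singleton.2 hpa
    · exact zero_mem _
  · rw [hdeg]
    exact_mod_cast Nat.pos_of_ne_zero hd
  · rw [Ideal.span_singleton_pow, Ideal.mem_span_singleton, Polynomial.coeff_sub,
      Polynomial.coeff_X_pow, if_neg hd.symm, zero_sub, dvd_neg, Polynomial.coeff_C_zero, sq]
    exact fun h => hp.not_isUnit (ha p h)

/-- Renaming variables along an injection preserves primality. -/
lemma MvPolynomial.prime_rename_of_injective {σ τ R : Type*} [CommRing R] {f : σ → τ}
    (hf : Function.Injective f) {p : MvPolynomial σ R} (hp : Prime p) : Prime (rename f p) := by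
  have h : rename f p =
      rename ((↑) : Set.range f → τ) (renameEquiv R (Equiv.ofInjective f hf) p) := by
    rw [renameEquiv_apply, rename_rename]
    rfl
  rw [h, prime_rename_iff]
  exact (MulEquiv.prime_iff (renameEquiv R (Equiv.ofInjective f hf))).2 hp

/-- `T ^ d - F` is prime when `F` is a squarefree nonzero nonunit not involving the variable `T`. -/
lemma MvPolynomial.prime_X_pow_sub_rename {σ τ K : Type*} [Field K] {F : MvPolynomial σ K}
    (hF : Squarefree F) (hF0 : F ≠ 0) (hFu : ¬IsUnit F) {d : ℕ} (hd : d ≠ 0) {f : σ → τ}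
    (hf : Function.Injective f) {t : τ} (ht : t ∉ Set.range f) :
    Prime (X t ^ d - rename f F : MvPolynomial τ K) := by
  have hopt : Prime (X none ^ d - rename some F : MvPolynomial (Option σ) K) := by
    rw [← MulEquiv.prime_iff (optionEquivLeft K σ)]
    have hsome : optionEquivLeft K σ (rename some F) = Polynomial.C F := by
      clear hF hF0 hFu
      induction F using MvPolynomial.induction_on <;> simp_all
    have := (Polynomial.irreducible_X_pow_sub_C_of_squarefree hF hF0 hFu hd).prime
    simpa [hsome] using this
  have hinj : Function.Injective (fun o : Option σ => o.elim t f) := by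
    rintro (_ | a) (_ | b) hab
    · rfl
    · exact absurd ⟨b, hab.symm⟩ ht
    · exact absurd ⟨a, hab⟩ ht
    · exact congrArg some (hf hab)
  have := prime_rename_of_injective hinj hopt
  simpa [rename_rename, Function.comp_def] using this

/-- The part `∑_{i ≥ 1} Xᵢ·Yᵢ` of `q`. -/
def qTail (N : ℕ) : S N := ∑ i : Fin N, X (Sum.inr i.succ) * X (Sum.inl i.succ)

lemma qPoly_eq_add_qTail (N : ℕ) :
    qPoly N = X (Sum.inr 0) * X (Sum.inl 0) + qTail N :=
  Fin.sum_univ_succ _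

lemma irreducible_qTail {N : ℕ} (hN : 2 ≤ N) : Irreducible (qTail N) := by
  classical
  let c : Fin (N + 1) →₀ ℂ := Finsupp.equivFunOnFinite.symm fun i => if i = 0 then 0 else 1
  have hc : sumSMulXSMulY c = qTail N := by
    simp only [sumSMulXSMulY, Finsupp.linearCombination_apply]
    rw [Finsupp.sum_fintype _ _ (by simp), Fin.sum_univ_succ]
    simp [c, qTail, mul_comm]
  rw [← hc]
  have hone : ∀ i, i ≠ 0 → c i = 1 := fun i hi => by simp [c, hi]
  refine irreducible_sumSMulXSMulY c
    ⟨⟨1, by omega⟩, ?_, ⟨2, by omega⟩, ?_, by simp⟩ fun r hr => ?_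
  · simp [hone, Fin.ext_iff]
  · simp [hone, Fin.ext_iff]
  · have := hr ⟨1, by omega⟩
    rw [hone _ (by simp [Fin.ext_iff])] at this
    exact isUnit_of_dvd_one this

/-- Setting the variable `i` to zero changes a polynomial by a multiple of that variable. -/
lemma MvPolynomial.X_dvd_sub_aeval_update_zero {σ R : Type*} [DecidableEq σ] [CommRing R] (i : σ)
    (f : MvPolynomial σ R) : X i ∣ f - aeval (Function.update X i 0) f := by
  rw [← Ideal.mem_span_singleton, ← Ideal.Quotient.eq]
  have : (Ideal.Quotient.mkₐ R (Ideal.span {(X i : MvPolynomial σ R)})) =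
      (Ideal.Quotient.mkₐ R (Ideal.span {(X i : MvPolynomial σ R)})).comp
        (aeval (Function.update X i 0)) := by
    ext j
    rcases eq_or_ne j i with rfl | hj
    · simp
    · simp [hj]
  exact DFunLike.congr_fun this f

section PrimePair

variable {N : ℕ} {P : S N}

/-- `q` is a nonzerodivisor modulo `(X₀, P)`. -/
lemma mem_span_of_mul_qPoly_mem (hN : 2 ≤ N)
    (hev : eval (Pi.single (Sum.inr (Fin.last N)) 1) P ≠ 0)
    {b : S N} (hb : b * qPoly N ∈ Ideal.span {X (Sum.inr 0), P}) :
    b ∈ Ideal.span {X (Sum.inr 0), P} := by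
  classical
  let s : S N →ₐ[ℂ] S N := aeval (Function.update X (Sum.inr 0) 0)
  have hs : ∀ f : S N, ∃ g, f - s f = X (Sum.inr 0) * g := X_dvd_sub_aeval_update_zero _
  have hsX : s (X (Sum.inr 0)) = 0 := by simp [s]
  have hlast : Fin.last N ≠ 0 := by simp [Fin.ext_iff]; omega
  have hsq : s (qPoly N) = qTail N := by
    simp [qPoly_eq_add_qTail, qTail, s]
  have hsev : ∀ f : S N, eval (Pi.single (Sum.inr (Fin.last N)) 1) (s f) =
      eval (Pi.single (Sum.inr (Fin.last N)) 1) f := by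
    intro f
    obtain ⟨g, hg⟩ := hs f
    have := congrArg (eval (Pi.single (Sum.inr (Fin.last N)) (1 : ℂ))) hg
    simp only [map_sub, map_mul, eval_X, zero_mul,
      Pi.single_eq_of_ne (Sum.inr_injective.ne hlast.symm)] at this
    exact (sub_eq_zero.1 this).symm
  have hprime := (irreducible_qTail hN).prime
  have hnd : ¬ qTail N ∣ s P := by
    rintro ⟨t, ht⟩
    refine hev ?_
    rw [← hsev, ht]
    simp [qTail]
  obtain ⟨c, e, hce⟩ := Ideal.mem_span_pair.1 hb
  have hse := congrArg s hce
  simp only [map_add, map_mul, hsX, hsq, mul_zero, zero_add] at hse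
  obtain ⟨t, ht⟩ := (hprime.dvd_or_dvd (Dvd.intro_left _ hse.symm)).resolve_right hnd
  have hsb : s b = t * s P := by
    apply mul_right_cancel₀ hprime.ne_zero
    rw [← hse, ht]
    ring
  obtain ⟨g, hg⟩ := hs b
  obtain ⟨g', hg'⟩ := hs P
  exact Ideal.mem_span_pair.2 ⟨g - t * g', t, by linear_combination t * hg' - hsb - hg⟩

/-- `X₀` is a nonzerodivisor modulo `(P, q)`. -/
lemma mem_span_of_X_mul_mem (hN : 2 ≤ N) (hP : Prime P) (hPX : ¬ P ∣ X (Sum.inr 0))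
    (hev : eval (Pi.single (Sum.inr (Fin.last N)) 1) P ≠ 0)
    {f : S N} (hf : X (Sum.inr 0) * f ∈ Ideal.span {P, qPoly N}) :
    f ∈ Ideal.span {P, qPoly N} := by
  obtain ⟨a, b, hab⟩ := Ideal.mem_span_pair.1 hf
  have hb : b * qPoly N ∈ Ideal.span {X (Sum.inr 0), P} :=
    Ideal.mem_span_pair.2 ⟨f, -a, by linear_combination -hab⟩
  obtain ⟨c, e, hce⟩ := Ideal.mem_span_pair.1 (mem_span_of_mul_qPoly_mem hN hev hb)
  have hdvd : P ∣ X (Sum.inr 0) * (f - c * qPoly N) :=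
    ⟨a + e * qPoly N, by linear_combination -hab - qPoly N * hce⟩
  obtain ⟨g, hg⟩ := (hP.dvd_or_dvd hdvd).resolve_left hPX
  exact Ideal.mem_span_pair.2 ⟨g, c, by linear_combination -hg⟩

/-- Modulo `q`, the variable `Y₀` can be eliminated after multiplying by a power of `X₀`. -/
lemma exists_qPoly_dvd_X_pow_mul_sub (f : S N) :
    ∃ (k : ℕ) (g : S N), g ∈ supported ℂ ({Sum.inl 0}ᶜ : Set (Fin (N + 1) ⊕ Fin (N + 1))) ∧
      qPoly N ∣ X (Sum.inr 0) ^ k * f - g := by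
  have hX : ∀ i : Fin (N + 1) ⊕ Fin (N + 1), i ≠ Sum.inl 0 →
      (X i : S N) ∈ supported ℂ ({Sum.inl 0}ᶜ : Set (Fin (N + 1) ⊕ Fin (N + 1))) :=
    fun i hi => X_mem_supported.2 hi
  induction f using MvPolynomial.induction_on with
  | C a => exact ⟨0, C a, Subalgebra.algebraMap_mem _ a, by simp⟩
  | add f₁ f₂ h₁ h₂ =>
    obtain ⟨k₁, g₁, hg₁, t₁, ht₁⟩ := h₁
    obtain ⟨k₂, g₂, hg₂, t₂, ht₂⟩ := h₂
    have hx := hX (Sum.inr 0) (by simp)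
    exact ⟨k₁ + k₂, X (Sum.inr 0) ^ k₂ * g₁ + X (Sum.inr 0) ^ k₁ * g₂,
      add_mem (mul_mem (pow_mem hx _) hg₁) (mul_mem (pow_mem hx _) hg₂),
      X (Sum.inr 0) ^ k₂ * t₁ + X (Sum.inr 0) ^ k₁ * t₂, by
        linear_combination X (Sum.inr 0) ^ k₂ * ht₁ + X (Sum.inr 0) ^ k₁ * ht₂⟩
  | mul_X f i h =>
    obtain ⟨k, g, hg, t, ht⟩ := h
    by_cases hi : i = Sum.inl 0
    · subst hi
      refine ⟨k + 1, g * -qTail N, mul_mem hg (neg_mem (sum_mem fun i _ =>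
        mul_mem (hX _ (by simp)) (hX _ (by simp)))),
        X (Sum.inr 0) * X (Sum.inl 0) * t + g, ?_⟩
      linear_combination X (Sum.inr 0) * X (Sum.inl 0) * ht - g * qPoly_eq_add_qTail N
    · exact ⟨k, g * X i, mul_mem hg (hX i hi), t * X i, by linear_combination X i * ht⟩

/-- A prime `P` in the `X`-variables, not vanishing at the point `X_N = 1` of the last coordinate
axis, generates together with `q` a prime ideal. -/
theorem isPrime_span_pair_qPoly (hN : 2 ≤ N) (hP : Prime P)
    (hsupp : P ∈ supported ℂ (Set.range (Sum.inr : Fin (N + 1) → Fin (N + 1) ⊕ Fin (N + 1))))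
    (hev : eval (Pi.single (Sum.inr (Fin.last N)) 1) P ≠ 0) :
    (Ideal.span {P, qPoly N}).IsPrime := by
  classical
  have hlast : Fin.last N ≠ 0 := by simp [Fin.ext_iff]; omega
  have hPX : ¬ P ∣ X (Sum.inr 0) := by
    intro h
    obtain ⟨t, ht⟩ := (hP.irreducible.associated_of_dvd X_prime.irreducible h).symm.dvd
    exact hev (by simp [ht, Pi.single_eq_of_ne (Sum.inr_injective.ne hlast.symm)])
  have : (Ideal.span {P}).IsPrime := (Ideal.span_singleton_prime hP.ne_zero).2 hP
  let K := FractionRing (S N ⧸ Ideal.span {P})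
  let π : S N →ₐ[ℂ] K :=
    (IsScalarTower.toAlgHom ℂ (S N ⧸ Ideal.span {P}) K).comp (Ideal.Quotient.mkₐ ℂ _)
  have hπ : ∀ f, π f = 0 ↔ P ∣ f := fun f => by
    rw [← Ideal.mem_span_singleton, ← Ideal.Quotient.eq_zero_iff_mem]
    exact (FaithfulSMul.algebraMap_eq_zero_iff (S N ⧸ Ideal.span {P}) K)
  have hx : π (X (Sum.inr 0)) ≠ 0 := fun h => hPX ((hπ _).1 h)
  let φ : S N →ₐ[ℂ] K := aeval (Function.update (fun j => π (X j)) (Sum.inl 0)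
    (-π (qTail N) / π (X (Sum.inr 0))))
  have hφ : ∀ f ∈ supported ℂ ({Sum.inl 0}ᶜ : Set (Fin (N + 1) ⊕ Fin (N + 1))), φ f = π f := by
    refine AlgHom.adjoin_le_equalizer φ π ?_
    rintro _ ⟨j, hj, rfl⟩
    simp [φ, Function.update_of_ne hj]
  have hφP : φ P = 0 := by
    rw [hφ P (supported_mono (by rintro _ ⟨i, rfl⟩; simp) hsupp), hπ]
  have hφq : φ (qPoly N) = 0 := by
    have htail : φ (qTail N) = π (qTail N) := hφ _ (sum_mem fun i _ =>
      mul_mem (X_mem_supported.2 (by simp)) (X_mem_supported.2 (by simp)))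
    have hX : φ (X (Sum.inr 0)) = π (X (Sum.inr 0)) := hφ _ (X_mem_supported.2 (by simp))
    have hY : φ (X (Sum.inl 0)) = -π (qTail N) / π (X (Sum.inr 0)) := by simp [φ]
    rw [qPoly_eq_add_qTail, map_add, map_mul, htail, hX, hY]
    rw [mul_div_cancel₀ _ hx, neg_add_cancel]
  have hker : Ideal.span {P, qPoly N} = RingHom.ker φ := by
    refine le_antisymm (Ideal.span_le.2 ?_) fun f hf => ?_
    · rintro _ (rfl | rfl)
      exacts [hφP, hφq]
    · obtain ⟨k, g, hg, t, ht⟩ := exists_qPoly_dvd_X_pow_mul_sub f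
      have hφg : φ g = 0 := by
        have := congrArg φ ht
        rw [map_sub, map_mul, (RingHom.mem_ker).1 hf, map_mul, hφq] at this
        simpa using this
      obtain ⟨u, hu⟩ := (hπ g).1 (hφ g hg ▸ hφg)
      have hmem : X (Sum.inr 0) ^ k * f ∈ Ideal.span {P, qPoly N} :=
        Ideal.mem_span_pair.2 ⟨u, t, by linear_combination -ht - hu⟩
      clear ht
      induction k with
      | zero => simpa using hmem
      | succ k ih =>
        rw [pow_succ', mul_assoc] at hmem
        exact ih (mem_span_of_X_mul_mem hN hP hPX hev hmem)
  rw [hker]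
  exact RingHom.ker_isPrime φ

end PrimePair

/-- For `P = X_N^d − F(X₀,…,X_{N−1})` with `F` homogeneous of degree `d ≥ 2`
whose partial derivatives only vanish simultaneously at the origin, the ideal `(P, q)` of `S`
is prime. -/
theorem statement2 (N : ℕ) (hN : 2 ≤ N) (d : ℕ) (hd : 2 ≤ d)
    (F : S N)
    (hFsupp : F ∈ MvPolynomial.supported ℂ
      (Set.range (fun i : Fin N => (Sum.inr i.castSucc : Fin (N + 1) ⊕ Fin (N + 1)))))
    (hFhom : F.IsWeightedHomogeneous (wX N) d)
    (hFsmooth : ∀ x : Fin N → ℂ,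
      (∀ i : Fin N,
        eval (Sum.elim (fun _ => (0 : ℂ)) (Fin.snoc x 0))
          (pderiv (Sum.inr i.castSucc) F) = 0) → x = 0) :
    (Ideal.span {X (Sum.inr (Fin.last N)) ^ d - F, qPoly N} : Ideal (S N)).IsPrime := by
  have hinj : Function.Injective
      (fun i : Fin N => (Sum.inr i.castSucc : Fin (N + 1) ⊕ Fin (N + 1))) :=
    Sum.inr_injective.comp (Fin.castSucc_injective N)
  obtain ⟨G, rfl⟩ : ∃ G : MvPolynomial (Fin N) ℂ,
      rename (fun i : Fin N => (Sum.inr i.castSucc : Fin (N + 1) ⊕ Fin (N + 1))) G = F :=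
    exists_rename_eq_of_vars_subset_range F _ hinj (mem_supported.1 hFsupp)
  have : Nontrivial (Fin N) := Fin.nontrivial_iff_two_le.2 hN
  have hsmooth : ∀ x : Fin N → ℂ, (∀ i, eval x (pderiv i G) = 0) → x = 0 := by
    refine fun x hx => hFsmooth x fun i => ?_
    rw [pderiv_rename hinj, eval_rename, ← hx i]
    congr 2
    funext j
    simp
  have hG0 : G ≠ 0 := by
    rintro rfl
    exact one_ne_zero (hsmooth 1 (by simp))
  have hconst : constantCoeff G = 0 := by
    rw [← constantCoeff_rename
      (fun i : Fin N => (Sum.inr i.castSucc : Fin (N + 1) ⊕ Fin (N + 1))), constantCoeff_eq]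
    refine hFhom.coeff_eq_zero 0 ?_
    simp only [map_zero]
    omega
  have hGu : ¬IsUnit G := fun h => by simpa [hconst] using h.map constantCoeff
  refine isPrime_span_pair_qPoly hN
    (prime_X_pow_sub_rename (squarefree_of_pderiv hsmooth) hG0 hGu (by omega) hinj ?_) ?_ ?_
  · rintro ⟨i, hi⟩
    exact (Fin.castSucc_lt_last i).ne (Sum.inr_injective hi)
  · refine sub_mem (pow_mem (X_mem_supported.2 (Set.mem_range_self _)) _) (supported_mono ?_ hFsupp)
    rintro _ ⟨i, rfl⟩
    exact ⟨_, rfl⟩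
  · have hzero : (Pi.single (Sum.inr (Fin.last N)) (1 : ℂ) ∘
        fun i : Fin N => (Sum.inr i.castSucc : Fin (N + 1) ⊕ Fin (N + 1))) = 0 := by
      funext i
      simp [(Fin.castSucc_lt_last i).ne]
    simp [eval_rename, hzero, hconst]
end
end
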